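/- Let Z be a compact subset of the real projective plane ℝP² (the projectivization of ℝ³ with its quotient topology) and let 𝔛 be a Z-valued switched Bebutov shift. If φ ∈ 𝔛 is recurrent with respect to the shift semiflow on 𝔛, then there exists a preperiodic element χ ∈ 𝔛 with χ(0) = φ(0). If moreover φ is injective, then χ may be chosen to be a constant function. -/

import Mathlib

open scoped NNReal
open Filter Topology

/-- The real projective plane: one-dimensional subspaces of `ℝ³`, with the quotient
topology induced from `ℝ³ ∖ {0}`. -/
noncomputable instance : TopologicalSpace (Projectivization ℝ (EuclideanSpace ℝ (Fin 3))) :=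
  inferInstanceAs (TopologicalSpace (Quotient _))

/-- The shift semiflow `σ^τ` on `C([0,∞), Z)`. -/
noncomputable def bebShift {Z : Type*} [TopologicalSpace Z] (τ : ℝ≥0) (φ : C(ℝ≥0, Z)) :
    C(ℝ≥0, Z) :=
  φ.comp ⟨fun t => t + τ, continuous_id.add continuous_const⟩

/-- A `Z`-valued switched Bebutov shift: a compact, shift-invariant subset of `C([0,∞), Z)`
(with the compact-open topology) satisfying the switching axiom. -/
def IsSwitchedBebutovShift {Z : Type*} [TopologicalSpace Z] (X : Set C(ℝ≥0, Z)) : Prop :=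
  IsCompact X ∧
  (∀ φ ∈ X, ∀ τ : ℝ≥0, bebShift τ φ ∈ X) ∧
  (∀ φ₁ ∈ X, ∀ φ₂ ∈ X, ∀ τ : ℝ≥0, 0 < τ → φ₁ τ = φ₂ τ →
    ∀ ψ : C(ℝ≥0, Z), (∀ t, t ≤ τ → ψ t = φ₁ t) → (∀ t, τ ≤ t → ψ t = φ₂ t) → ψ ∈ X)

/-- `φ` is recurrent with respect to the shift semiflow: there is a sequence `tₙ → ∞`
with `σ^{tₙ}φ → φ` in the compact-open topology. -/
def IsShiftRecurrent {Z : Type*} [TopologicalSpace Z] (φ : C(ℝ≥0, Z)) : Prop :=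
  ∃ t : ℕ → ℝ≥0, Tendsto t atTop atTop ∧ Tendsto (fun n => bebShift (t n) φ) atTop (𝓝 φ)

theorem exists_continuous_log {E : Type*} [NormedAddCommGroup E] [NormedSpace ℝ E] {g : E → ℂ}
    (hg : Continuous g) (h0 : ∀ x, g x ≠ 0) :
    ∃ f : E → ℂ, Continuous f ∧ ∀ x, Complex.exp (f x) = g x := by
  have hs : IsSimplyConnected (Set.univ : Set E) := by
    have : ContractibleSpace (Set.univ : Set E) :=
      convex_univ.contractibleSpace Set.univ_nonempty
    exact (inferInstance : SimplyConnectedSpace (Set.univ : Set E))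
  have : LocallyConvexSpace ℝ E := inferInstance
  obtain ⟨f, hf, hfg⟩ := Complex.exists_continuousOn_eqOn_exp_comp hs isOpen_univ
    hg.continuousOn (by rintro ⟨x, -, hx⟩; exact h0 x hx)
  exact ⟨f, continuousOn_univ.1 hf, fun x => hfg (Set.mem_univ x)⟩

theorem continuousOn_eq_of_exp_eq {f : ℝ → ℂ} {s : Set ℝ} (hs : IsPreconnected s)
    (hf : ContinuousOn f s) {c : ℂ} (h : ∀ t ∈ s, Complex.exp (f t) = c) {a b : ℝ}
    (ha : a ∈ s) (hb : b ∈ s) : f a = f b := by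
  refine Complex.isCoveringMap_exp.eqOn_of_comp_eqOn hs hf
    (continuousOn_const (c := f b)) (fun t ht => ?_) hb rfl ha
  simp only [Function.comp, Subtype.mk.injEq]
  rw [h t ht, h b hb]

theorem continuousOn_log_div {f g : ℝ → ℂ} {s : Set ℝ} (hf : ContinuousOn f s)
    (hg : ContinuousOn g s) (h0 : ∀ t ∈ s, g t ≠ 0)
    (h : ∀ t ∈ s, ‖f t - g t‖ ≤ 1 / 300 * ‖g t‖) :
    ContinuousOn (fun t => Complex.log (f t / g t)) s := by
  refine (hf.div hg h0).clog fun t ht => ?_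
  have hp : 0 < ‖g t‖ := norm_pos_iff.2 (h0 t ht)
  have := Complex.mem_slitPlane_of_norm_lt_one (z := (f t - g t) / g t) (by
    rw [norm_div, div_lt_one hp]; linarith [h t ht])
  have h1 := h0 t ht
  have h2 : f t / g t = 1 + (f t - g t) / g t := by field_simp; ring
  rw [Pi.div_apply, h2]; exact this

theorem norm_log_div_le {z w : ℂ} (hw : w ≠ 0) (h : ‖z - w‖ ≤ 1 / 300 * ‖w‖) :
    ‖Complex.log (z / w)‖ ≤ 1 / 200 := by
  have hp : 0 < ‖w‖ := norm_pos_iff.2 hw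
  have h1 : ‖(z - w) / w‖ ≤ 1 / 300 := by rw [norm_div, div_le_iff₀ hp]; exact h
  have := Complex.norm_log_one_add_half_le_self (z := (z - w) / w) (by linarith)
  have h2 : z / w = 1 + (z - w) / w := by field_simp; ring
  rw [h2]; linarith

theorem ne_zero_of_close {z w : ℂ} (hw : w ≠ 0) (h : ‖z - w‖ ≤ 1 / 300 * ‖w‖) : z ≠ 0 := by
  rintro rfl
  have hp : 0 < ‖w‖ := norm_pos_iff.2 hw
  simp at h; linarith

/-- Logarithms of two uniformly close functions have nearly the same increment. -/
theorem norm_increment_sub_le {F G f g : ℝ → ℂ} {a b : ℝ} (hab : a ≤ b)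
    (hF : ContinuousOn F (Set.Icc a b)) (hG : ContinuousOn G (Set.Icc a b)) {c₁ c₂ : ℂ}
    (h₁ : ∀ t ∈ Set.Icc a b, Complex.exp (F t) = c₁ * f t)
    (h₂ : ∀ t ∈ Set.Icc a b, Complex.exp (G t) = c₂ * g t)
    (h : ∀ t ∈ Set.Icc a b, ‖f t - g t‖ ≤ 1 / 300 * ‖g t‖) :
    ‖(F b - F a) - (G b - G a)‖ ≤ 1 / 100 := by
  have ha : a ∈ Set.Icc a b := ⟨le_rfl, hab⟩
  have hb : b ∈ Set.Icc a b := ⟨hab, le_rfl⟩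
  have hc1 : c₁ ≠ 0 := by
    rintro rfl; exact Complex.exp_ne_zero _ ((h₁ a ha).trans (zero_mul _))
  have hc2 : c₂ ≠ 0 := by
    rintro rfl; exact Complex.exp_ne_zero _ ((h₂ a ha).trans (zero_mul _))
  have hg0 : ∀ t ∈ Set.Icc a b, g t ≠ 0 := fun t ht h0 =>
    Complex.exp_ne_zero (G t) (by rw [h₂ t ht, h0, mul_zero])
  have hf : ContinuousOn f (Set.Icc a b) := by
    refine (hF.cexp.const_smul (c₁⁻¹)).congr fun t ht => ?_
    simp [h₁ t ht, hc1]
  have hg : ContinuousOn g (Set.Icc a b) := by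
    refine (hG.cexp.const_smul (c₂⁻¹)).congr fun t ht => ?_
    simp [h₂ t ht, hc2]
  have hf0 : ∀ t ∈ Set.Icc a b, f t ≠ 0 := fun t ht => ne_zero_of_close (hg0 t ht) (h t ht)
  have key := continuousOn_eq_of_exp_eq (f := fun t => F t - G t - Complex.log (f t / g t))
    (c := c₁ / c₂) isPreconnected_Icc ((hF.sub hG).sub (continuousOn_log_div hf hg hg0 h))
    (fun t ht => by
      have := hg0 t ht; have := hf0 t ht
      rw [Complex.exp_sub, Complex.exp_sub, Complex.exp_log (div_ne_zero ‹_› ‹_›), h₁ t ht, h₂ t ht]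
      field_simp) hb ha
  have e : (F b - F a) - (G b - G a) = Complex.log (f b / g b) - Complex.log (f a / g a) := by
    linear_combination key
  rw [e]
  refine (norm_sub_le _ _).trans ?_
  linarith [norm_log_div_le (hg0 b hb) (h b hb), norm_log_div_le (hg0 a ha) (h a ha)]

/-- A symmetric family of logarithms of the chords of a path. -/
structure IsChordLog (φ : ℝ → ℂ) (Λ : ℝ → ℝ → ℂ) : Prop where
  symm : ∀ s t, Λ s t = Λ t s
  exp_eq : ∀ s t, 0 ≤ s → s < t → Complex.exp (Λ s t) = φ t - φ s
  cont : ∀ c, 0 ≤ c → ContinuousOn (Λ c) {t | 0 ≤ t ∧ t ≠ c}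

theorem exists_isChordLog {φ : ℝ → ℂ} (hφ : Continuous φ) (hi : Set.InjOn φ (Set.Ici 0)) :
    ∃ Λ, IsChordLog φ Λ := by
  obtain ⟨F, hF, hFe⟩ := exists_continuous_log (E := ℝ × ℝ)
    (g := fun x => φ (max x.1 0 + Real.exp x.2) - φ (max x.1 0)) (by fun_prop) (fun x h => by
      have h1 : (0:ℝ) ≤ max x.1 0 := le_max_right _ _
      have := hi (Set.mem_Ici.2 (by positivity)) (Set.mem_Ici.2 h1) (sub_eq_zero.1 h)
      linarith [Real.exp_pos x.2])
  refine ⟨fun s t => F (min s t, Real.log |t - s|), ?_, ?_, ?_⟩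
  · intro s t; simp only [min_comm, abs_sub_comm]
  · intro s t hs hst
    have : 0 < t - s := sub_pos.2 hst
    simp only [hFe]
    rw [min_eq_left hst.le, max_eq_left hs, abs_of_pos this, Real.exp_log this]
    congr 2; ring
  · intro c hc
    refine hF.comp_continuousOn ((by fun_prop : Continuous fun t => min c t).continuousOn.prodMk ?_)
    exact ContinuousOn.log (by fun_prop) (fun t ht => by
      simpa [sub_eq_zero] using ht.2)

theorem IsChordLog.exists_sign {φ : ℝ → ℂ} {Λ : ℝ → ℝ → ℂ} (hΛ : IsChordLog φ Λ) {a b c : ℝ}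
    (ha : 0 ≤ a) (hc : 0 ≤ c) (h : c < a ∨ b < c) :
    ∃ k : ℂ, ∀ t ∈ Set.Icc a b, Complex.exp (Λ c t) = k * (φ t - φ c) := by
  rcases h with h | h
  · exact ⟨1, fun t ht => by rw [hΛ.exp_eq c t hc (h.trans_le ht.1), one_mul]⟩
  · refine ⟨-1, fun t ht => ?_⟩
    rw [hΛ.symm, hΛ.exp_eq t c (ha.trans ht.1) (ht.2.trans_lt h)]; ring

theorem IsChordLog.cont_Icc {φ : ℝ → ℂ} {Λ : ℝ → ℝ → ℂ} (hΛ : IsChordLog φ Λ) {a b c : ℝ}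
    (ha : 0 ≤ a) (hc : 0 ≤ c) (h : c < a ∨ b < c) : ContinuousOn (Λ c) (Set.Icc a b) :=
  (hΛ.cont c hc).mono fun t ht => ⟨ha.trans ht.1, by
    rintro rfl; rcases h with h | h
    · exact absurd ht.1 (not_le.2 h)
    · exact absurd ht.2 (not_le.2 h)⟩

/-- Data around an arc `φ '' [α, β]` of a planar path along which the path never travels
backwards. -/
structure Frame (φ : ℝ → ℂ) (Λ : ℝ → ℝ → ℂ) where
  (α β u₀ δ η r : ℝ)
  (q : ℂ)
  (π : ℂ → ℝ)
  (lam μα μβ : ℝ → ℂ)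
  cont : Continuous φ
  inj : Set.InjOn φ (Set.Ici 0)
  log : IsChordLog φ Λ
  α_nonneg : 0 ≤ α
  α_lt : α < u₀
  lt_β : u₀ < β
  π_mem : ∀ x, π x ∈ Set.Icc α β
  π_cont : Continuous π
  δ_pos : 0 < δ
  δ_le : δ ≤ η
  η_le : 1000 * η ≤ r
  track : ∀ x, Metric.infDist x (φ '' Set.Icc α β) ≤ δ → ‖x - φ (π x)‖ ≤ η
  noreverse : ∀ u v, u ∈ ({α, u₀} : Set ℝ) → v ∈ ({u₀, β} : Set ℝ) → u < v →
    ∀ t₁ t₂, 0 ≤ t₁ → t₁ < t₂ → ‖φ t₁ - φ v‖ ≤ r → ‖φ t₂ - φ u‖ ≤ r →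
    ¬ ∀ t ∈ Set.Icc t₁ t₂, Metric.infDist (φ t) (φ '' Set.Icc α β) ≤ δ
  farα : 2 * r < ‖φ u₀ - φ α‖
  farβ : 2 * r < ‖φ u₀ - φ β‖
  farαβ : 2 * r < ‖φ α - φ β‖
  closeα₀ : ∀ x, ‖x - φ u₀‖ ≤ 4 * η → ‖Λ α (π x) - Λ α u₀‖ ≤ 1 / 100
  closeαβ : ∀ x, ‖x - φ β‖ ≤ 4 * η → ‖Λ α (π x) - Λ α β‖ ≤ 1 / 100
  closeβ₀ : ∀ x, ‖x - φ u₀‖ ≤ 4 * η → ‖Λ β (π x) - Λ β u₀‖ ≤ 1 / 100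
  closeβα : ∀ x, ‖x - φ α‖ ≤ 4 * η → ‖Λ β (π x) - Λ β α‖ ≤ 1 / 100
  closeα : ∀ x, ‖x - φ α‖ ≤ 4 * η → π x < u₀ ∧ ‖lam (π x) - lam α‖ ≤ 1 / 100
  closeβ : ∀ x, ‖x - φ β‖ ≤ 4 * η → u₀ < π x ∧ ‖lam (π x) - lam β‖ ≤ 1 / 100
  lam_cont : Continuous lam
  lam_exp : ∀ u ∈ Set.Icc α β, Complex.exp (lam u) = φ u - q
  farq : ∀ u ∈ Set.Icc α β, 300 * η ≤ ‖φ u - q‖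
  μα_cont : Continuous μα
  μβ_cont : Continuous μβ
  μα_exp : ∀ ρ ∈ Set.Icc (0 : ℝ) 1, Complex.exp (μα ρ) = φ α - (q + ρ * (φ u₀ - q))
  μβ_exp : ∀ ρ ∈ Set.Icc (0 : ℝ) 1, Complex.exp (μβ ρ) = φ β - (q + ρ * (φ u₀ - q))
  farμα : ∀ ρ ∈ Set.Icc (0 : ℝ) 1, 1500 * η ≤ ‖φ α - (q + ρ * (φ u₀ - q))‖
  farμβ : ∀ ρ ∈ Set.Icc (0 : ℝ) 1, 1500 * η ≤ ‖φ β - (q + ρ * (φ u₀ - q))‖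
  outside : 2 * δ < Metric.infDist (φ (β + 1)) (φ '' Set.Icc α β)
  nearest : ∀ u ∈ Set.Icc α β, ‖φ u₀ - q‖ ≤ ‖φ u - q‖

namespace Frame

variable {φ : ℝ → ℂ} {Λ : ℝ → ℝ → ℂ} (S : Frame φ Λ)

/-- The arc of the frame. -/
def arc : Set ℂ := φ '' Set.Icc S.α S.β

/-- Times at which the path is in the tube around the arc. -/
def tube : Set ℝ := {t | Metric.infDist (φ t) S.arc ≤ S.δ}

/-- `[c, d]` is a passage of the path along the arc. -/
structure Strand (c d : ℝ) : Prop where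
  nonneg : 0 ≤ c
  lt : c < d
  left : ‖φ c - φ S.α‖ ≤ S.δ
  right : ‖φ d - φ S.β‖ ≤ S.δ
  sub : Set.Icc c d ⊆ S.tube

/-- Times at which the path is near the middle point of the arc. -/
def Near (t : ℝ) : Prop := ‖φ t - φ S.u₀‖ ≤ 4 * S.η

/-- The total sweep of the arc as computed from the first strand. -/
noncomputable def g : ℂ :=
  (S.lam S.β - S.lam S.α) + (S.μβ 1 - S.μβ 0) - (S.μα 1 - S.μα 0)

/-- The mean sweep of two disjoint strands. -/
noncomputable def h : ℂ := Λ S.u₀ S.β - Λ S.α S.u₀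

lemma η_pos : 0 < S.η := S.δ_pos.trans_le S.δ_le

lemma r_pos : 0 < S.r := by linarith [S.η_pos, S.η_le]

lemma u₀_nonneg : 0 ≤ S.u₀ := S.α_nonneg.trans S.α_lt.le

lemma β_nonneg : 0 ≤ S.β := S.u₀_nonneg.trans S.lt_β.le

lemma α_lt_β : S.α < S.β := S.α_lt.trans S.lt_β

lemma u₀_mem : S.u₀ ∈ Set.Icc S.α S.β := ⟨S.α_lt.le, S.lt_β.le⟩

lemma leg {γ f a b : ℝ} {k : ℂ} (hγ : 0 ≤ γ)
    (hk : ∀ v ∈ Set.Icc S.α S.β, v ≠ γ → Complex.exp (Λ γ v) = k * (φ v - φ γ))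
    (hf : 0 ≤ f) (hfγ : ‖φ f - φ γ‖ ≤ S.η) (ha : 0 ≤ a) (hab : a ≤ b) (hfab : f < a ∨ b < f)
    (ht : Set.Icc a b ⊆ S.tube) (hr : ∀ t ∈ Set.Icc a b, S.r ≤ ‖φ t - φ γ‖) :
    ‖(Λ f b - Λ f a) - (Λ γ (S.π (φ b)) - Λ γ (S.π (φ a)))‖ ≤ 1 / 100 := by
  obtain ⟨k', hk'⟩ := S.log.exists_sign ha hf hfab
  have hη := S.η_pos
  have hηr := S.η_le
  have tr : ∀ t ∈ Set.Icc a b, ‖φ t - φ (S.π (φ t))‖ ≤ S.η := fun t h => S.track _ (ht h)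
  have far : ∀ t ∈ Set.Icc a b, S.r - S.η ≤ ‖φ (S.π (φ t)) - φ γ‖ := fun t h => by
    have := norm_sub_le_norm_sub_add_norm_sub (φ t) (φ (S.π (φ t))) (φ γ)
    linarith [tr t h, hr t h]
  have ne : ∀ t ∈ Set.Icc a b, S.π (φ t) ≠ γ := fun t h e => by
    have := far t h
    rw [e, sub_self, norm_zero] at this
    linarith
  refine norm_increment_sub_le (F := Λ f) (G := fun t => Λ γ (S.π (φ t)))
    (f := fun t => φ t - φ f) (g := fun t => φ (S.π (φ t)) - φ γ) hab
    (S.log.cont_Icc ha hf hfab) ?_ hk' (fun t h => hk _ (S.π_mem _) (ne t h)) ?_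
  · refine (S.log.cont γ hγ).comp (S.π_cont.comp S.cont).continuousOn fun t h => ?_
    exact ⟨S.α_nonneg.trans (S.π_mem _).1, ne t h⟩
  · intro t h
    have e : φ t - φ f - (φ (S.π (φ t)) - φ γ) = (φ t - φ (S.π (φ t))) - (φ f - φ γ) := by ring
    rw [e]
    have := norm_sub_le (φ t - φ (S.π (φ t))) (φ f - φ γ)
    linarith [tr t h, far t h]

lemma legα {f a b : ℝ} (hf : 0 ≤ f) (hfγ : ‖φ f - φ S.α‖ ≤ S.η) (ha : 0 ≤ a) (hab : a ≤ b)
    (hfab : f < a ∨ b < f) (ht : Set.Icc a b ⊆ S.tube)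
    (hr : ∀ t ∈ Set.Icc a b, S.r ≤ ‖φ t - φ S.α‖) :
    ‖(Λ f b - Λ f a) - (Λ S.α (S.π (φ b)) - Λ S.α (S.π (φ a)))‖ ≤ 1 / 100 :=
  S.leg (k := 1) S.α_nonneg (fun v hv hne => by
    rw [S.log.exp_eq _ _ S.α_nonneg (lt_of_le_of_ne hv.1 hne.symm), one_mul])
    hf hfγ ha hab hfab ht hr

lemma legβ {f a b : ℝ} (hf : 0 ≤ f) (hfγ : ‖φ f - φ S.β‖ ≤ S.η) (ha : 0 ≤ a) (hab : a ≤ b)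
    (hfab : f < a ∨ b < f) (ht : Set.Icc a b ⊆ S.tube)
    (hr : ∀ t ∈ Set.Icc a b, S.r ≤ ‖φ t - φ S.β‖) :
    ‖(Λ f b - Λ f a) - (Λ S.β (S.π (φ b)) - Λ S.β (S.π (φ a)))‖ ≤ 1 / 100 :=
  S.leg (k := -1) S.β_nonneg (fun v hv hne => by
    rw [S.log.symm, S.log.exp_eq _ _ (S.α_nonneg.trans hv.1) (lt_of_le_of_ne hv.2 hne)]; ring)
    hf hfγ ha hab hfab ht hr

lemma near_far_α {t : ℝ} (ht : S.Near t) : S.r < ‖φ t - φ S.α‖ := by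
  have h : ‖φ t - φ S.u₀‖ ≤ 4 * S.η := ht
  have := norm_sub_le_norm_sub_add_norm_sub (φ S.u₀) (φ t) (φ S.α)
  rw [norm_sub_rev (φ S.u₀) (φ t)] at this
  linarith [S.farα, S.η_le, S.η_pos]

lemma near_far_β {t : ℝ} (ht : S.Near t) : S.r < ‖φ t - φ S.β‖ := by
  have h : ‖φ t - φ S.u₀‖ ≤ 4 * S.η := ht
  have := norm_sub_le_norm_sub_add_norm_sub (φ S.u₀) (φ t) (φ S.β)
  rw [norm_sub_rev (φ S.u₀) (φ t)] at this
  linarith [S.farβ, S.η_le, S.η_pos]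

lemma far_α_of_near {t t' : ℝ} (h0 : 0 ≤ t) (htt : t ≤ t') (ht : S.Near t)
    (hs : Set.Icc t t' ⊆ S.tube) : S.r ≤ ‖φ t' - φ S.α‖ := by
  by_contra! hlt
  have h : ‖φ t - φ S.u₀‖ ≤ 4 * S.η := ht
  rcases htt.eq_or_lt with rfl | htt
  · exact absurd hlt (not_lt.2 (S.near_far_α ht).le)
  · exact S.noreverse S.α S.u₀ (by simp) (by simp) S.α_lt t t' h0 htt
      (by linarith [S.η_le, S.η_pos]) hlt.le hs

lemma far_β_of_near {t t' : ℝ} (h0 : 0 ≤ t') (htt : t' ≤ t) (ht : S.Near t)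
    (hs : Set.Icc t' t ⊆ S.tube) : S.r ≤ ‖φ t' - φ S.β‖ := by
  by_contra! hlt
  have h : ‖φ t - φ S.u₀‖ ≤ 4 * S.η := ht
  rcases htt.eq_or_lt with rfl | htt
  · exact absurd hlt (not_lt.2 (S.near_far_β ht).le)
  · exact S.noreverse S.u₀ S.β (by simp) (by simp) S.lt_β t' t h0 htt hlt.le
      (by linarith [S.η_le, S.η_pos]) hs

/-- The comparison of two disjoint strands. -/
lemma chord_sub_chord {c d c' d' s t : ℝ} (hX : S.Strand c d) (hY : S.Strand c' d')
    (hd : d < c' ∨ d' < c) (hs : s ∈ Set.Icc c d) (ht : t ∈ Set.Icc c' d')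
    (hsn : S.Near s) (htn : S.Near t) : ‖Λ s d' - Λ c t - S.h‖ ≤ 6 / 100 := by
  have hη := S.η_pos
  have hδ := S.δ_le
  have t0 : 0 ≤ t := hY.nonneg.trans ht.1
  have sub1 : Set.Icc t d' ⊆ S.tube := (Set.Icc_subset_Icc_left ht.1).trans hY.sub
  have sub2 : Set.Icc c s ⊆ S.tube := (Set.Icc_subset_Icc_right hs.2).trans hX.sub
  have l1 := S.legα hX.nonneg (hX.left.trans hδ) t0 ht.2
    (hd.imp (fun h => by linarith [hX.lt, ht.1]) id) sub1
    (fun x hx => S.far_α_of_near t0 hx.1 htn ((Set.Icc_subset_Icc_right hx.2).trans sub1))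
  have l2 := S.legβ (hY.nonneg.trans hY.lt.le) (hY.right.trans hδ) hX.nonneg hs.1
    (hd.symm.imp id (fun h => by linarith [hY.lt, hs.2])) sub2
    (fun x hx => S.far_β_of_near (hX.nonneg.trans hx.1) hx.2 hsn
      ((Set.Icc_subset_Icc_left hx.1).trans sub2))
  have a1 := S.closeαβ (φ d') (by linarith [hY.right])
  have a2 := S.closeα₀ (φ t) htn
  have a3 := S.closeβ₀ (φ s) hsn
  have a4 := S.closeβα (φ c) (by linarith [hX.left])
  have e : Λ s d' - Λ c t - S.h =
      ((Λ c d' - Λ c t) - (Λ S.α (S.π (φ d')) - Λ S.α (S.π (φ t))))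
      + ((Λ d' s - Λ d' c) - (Λ S.β (S.π (φ s)) - Λ S.β (S.π (φ c))))
      + (Λ S.α (S.π (φ d')) - Λ S.α S.β) - (Λ S.α (S.π (φ t)) - Λ S.α S.u₀)
      + (Λ S.β (S.π (φ s)) - Λ S.β S.u₀) - (Λ S.β (S.π (φ c)) - Λ S.β S.α) := by
    rw [h, S.log.symm d' s, S.log.symm d' c, S.log.symm S.β S.u₀, S.log.symm S.β S.α]; ring
  rw [e]
  refine (norm_sub_le _ _).trans ?_
  refine (add_le_add_left ((norm_add_le _ _).trans
    (add_le_add_left ((norm_sub_le _ _).trans (add_le_add_left ((norm_add_le _ _).trans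
    (add_le_add_left (norm_add_le _ _) _)) _)) _)) _).trans ?_
  linarith

lemma sweep_add_sweep {c d c' d' s t : ℝ} (hX : S.Strand c d) (hY : S.Strand c' d')
    (hd : d < c' ∨ d' < c) (hs : s ∈ Set.Icc c d) (ht : t ∈ Set.Icc c' d')
    (hsn : S.Near s) (htn : S.Near t) :
    ‖(Λ d t - Λ c t) + (Λ d' s - Λ c' s) - 2 * S.h‖ ≤ 12 / 100 := by
  have h1 := S.chord_sub_chord hX hY hd hs ht hsn htn
  have h2 := S.chord_sub_chord hY hX hd.symm ht hs htn hsn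
  have e : (Λ d t - Λ c t) + (Λ d' s - Λ c' s) - 2 * S.h =
    (Λ s d' - Λ c t - S.h) + (Λ t d - Λ c' s - S.h) := by
    rw [S.log.symm d t, S.log.symm d' s]; ring
  rw [e]
  exact (norm_add_le _ _).trans (by linarith)

lemma exists_near {c d : ℝ} (hX : S.Strand c d) :
    ∃ t ∈ Set.Icc c d, ‖φ t - φ S.u₀‖ ≤ S.η := by
  have h1 := (S.closeα (φ c) (by linarith [hX.left, S.δ_le, S.η_pos])).1
  have h2 := (S.closeβ (φ d) (by linarith [hX.right, S.δ_le, S.η_pos])).1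
  obtain ⟨t, ht, e⟩ := intermediate_value_Icc (f := fun t => S.π (φ t)) hX.lt.le
    (S.π_cont.comp S.cont).continuousOn ⟨h1.le, h2.le⟩
  refine ⟨t, ht, ?_⟩
  have := S.track (φ t) (hX.sub ht)
  simp only at e
  rwa [e] at this

lemma q_far {t : ℝ} (ht : t ∈ S.tube) : ‖φ S.u₀ - S.q‖ - S.δ ≤ ‖φ t - S.q‖ := by
  obtain ⟨y, ⟨u, hu, rfl⟩, h⟩ : ∃ y ∈ φ '' Set.Icc S.α S.β,
      Metric.infDist (φ t) (φ '' Set.Icc S.α S.β) = dist (φ t) y :=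
    (isCompact_Icc.image S.cont).exists_infDist_eq_dist ⟨_, S.u₀, S.u₀_mem, rfl⟩ _
  have h1 : Metric.infDist (φ t) (φ '' Set.Icc S.α S.β) ≤ S.δ := ht
  rw [h, dist_eq_norm] at h1
  have := norm_sub_le_norm_sub_add_norm_sub (φ u) (φ t) S.q
  rw [norm_sub_rev (φ u) (φ t)] at this
  linarith [S.nearest u hu]

/-- Among finitely many strands, one is met first when travelling from `q` to the arc. -/
lemma exists_first_touch {ι : Type*} [Finite ι] [Nonempty ι] {c d : ι → ℝ}
    (hX : ∀ i, S.Strand (c i) (d i)) :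
    ∃ i, ∃ t ∈ Set.Icc (c i) (d i), S.Near t ∧ ∀ j, ∀ s ∈ Set.Icc (c j) (d j),
      ∀ ρ ∈ Set.Ico (0 : ℝ) 1, S.q + ρ * (φ t - S.q) ≠ φ s := by
  classical
  let i₀ : ι := Classical.arbitrary ι
  obtain ⟨s₀, hs₀, hn⟩ := S.exists_near (hX i₀)
  let K : Set ℂ := ⋃ i, φ '' Set.Icc (c i) (d i)
  have hK : IsCompact K := isCompact_iUnion fun i => isCompact_Icc.image S.cont
  let R : Set ℝ := Set.Icc 0 1 ∩ (fun ρ : ℝ => S.q + ρ * (φ s₀ - S.q)) ⁻¹' K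
  have hR : IsCompact R := isCompact_Icc.inter_right (hK.isClosed.preimage (by fun_prop))
  have h1 : (1 : ℝ) ∈ R := ⟨by simp, Set.mem_iUnion.2 ⟨i₀, s₀, hs₀, by simp⟩⟩
  obtain ⟨ρ₀, ⟨hρ, hρK⟩, hmin⟩ := hR.exists_isLeast ⟨1, h1⟩
  obtain ⟨i, t, ht, e⟩ := Set.mem_iUnion.1 hρK
  have hη := S.η_pos
  have hδ := S.δ_le
  have hq0 := S.farq S.u₀ S.u₀_mem
  have hqt := S.q_far ((hX i).sub ht)
  simp only at e
  have e' : φ t - S.q = ρ₀ * (φ s₀ - S.q) := by rw [e]; ring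
  refine ⟨i, t, ht, ?_, ?_⟩
  · have n1 : ‖φ t - S.q‖ = ρ₀ * ‖φ s₀ - S.q‖ := by
      rw [e', norm_mul, Complex.norm_real, Real.norm_of_nonneg hρ.1]
    have n2 : ‖φ t - φ s₀‖ = (1 - ρ₀) * ‖φ s₀ - S.q‖ := by
      have : φ t - φ s₀ = -(((1 - ρ₀ : ℝ) : ℂ) * (φ s₀ - S.q)) := by
        push_cast; linear_combination e'
      rw [this, norm_neg, norm_mul, Complex.norm_real, Real.norm_of_nonneg (by linarith [hρ.2])]
    have n3 := norm_sub_le_norm_sub_add_norm_sub (φ s₀) (φ S.u₀) S.q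
    have n4 := norm_sub_le_norm_sub_add_norm_sub (φ t) (φ s₀) (φ S.u₀)
    unfold Near
    linarith
  · rintro j s hs ρ hρ' e2
    have : ρ * ρ₀ ∈ R := by
      refine ⟨⟨mul_nonneg hρ'.1 hρ.1, mul_le_one₀ hρ'.2.le hρ.1 hρ.2⟩,
        Set.mem_iUnion.2 ⟨j, s, hs, ?_⟩⟩
      rw [← e2, e']; push_cast; ring
    have h2 := hmin this
    have h3 : ρ₀ = 0 := by nlinarith [hρ.1, hρ'.2]
    rw [h3] at e'
    simp only [Complex.ofReal_zero, zero_mul] at e'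
    rw [e', norm_zero] at hqt
    linarith

lemma sweep_of_touch {c d t : ℝ} (hX : S.Strand c d) (ht0 : 0 ≤ t) (ht : t < c ∨ d < t)
    (hn : S.Near t) (hfree : ∀ s ∈ Set.Icc c d, ∀ ρ ∈ Set.Ico (0 : ℝ) 1,
      S.q + ρ * (φ t - S.q) ≠ φ s) : ‖Λ d t - Λ c t - S.g‖ ≤ 6 / 100 := by
  have hc0 := hX.nonneg
  have hcd := hX.lt
  have hη := S.η_pos
  have hδ := S.δ_le
  have hn' : ‖φ t - φ S.u₀‖ ≤ 4 * S.η := hn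
  obtain ⟨L, hL, hLe⟩ := exists_continuous_log (E := ℝ × ℝ)
    (g := fun x => φ (max c (min x.2 d)) -
      (S.q + ((max 0 (min x.1 1) : ℝ) : ℂ) * (φ t - S.q))) (by have := S.cont; fun_prop) (by
    rintro ⟨ρ, s⟩ h0
    simp only at h0
    have hs : max c (min s d) ∈ Set.Icc c d := ⟨le_max_left _ _, max_le hcd.le (min_le_right _ _)⟩
    have h0' := sub_eq_zero.1 h0
    set s' := max c (min s d)
    have hρ : max 0 (min ρ 1) ∈ Set.Icc (0:ℝ) 1 :=
      ⟨le_max_left _ _, max_le zero_le_one (min_le_right _ _)⟩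
    set ρ' := max 0 (min ρ 1)
    rcases hρ.2.eq_or_lt with h1 | h1
    · rw [h1] at h0'
      have h2 : φ s' = φ t := by rw [h0']; push_cast; ring
      have h3 := S.inj (Set.mem_Ici.2 (hc0.trans hs.1)) (Set.mem_Ici.2 ht0) h2
      rcases ht with h | h
      · linarith [hs.1]
      · linarith [hs.2]
    · exact hfree s' hs ρ' ⟨hρ.1, h1⟩ h0'.symm)
  have hL' : ∀ ρ ∈ Set.Icc (0:ℝ) 1, ∀ s ∈ Set.Icc c d,
      Complex.exp (L (ρ, s)) = φ s - (S.q + ρ * (φ t - S.q)) := by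
    intro ρ hρ s hs
    rw [hLe]; simp only
    rw [min_eq_left hs.2, max_eq_right hs.1, min_eq_left hρ.2, max_eq_right hρ.1]
  have hcc : c ∈ Set.Icc c d := ⟨le_rfl, hcd.le⟩
  have hdd : d ∈ Set.Icc c d := ⟨hcd.le, le_rfl⟩
  have one_mem : (1:ℝ) ∈ Set.Icc (0:ℝ) 1 := by simp
  have zero_mem : (0:ℝ) ∈ Set.Icc (0:ℝ) 1 := by simp
  have hLs : ∀ ρ, Continuous fun s => L (ρ, s) := fun ρ => hL.comp (by fun_prop)
  have hLr : ∀ s, Continuous fun ρ => L (ρ, s) := fun s => hL.comp (by fun_prop)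
  obtain ⟨k, hk⟩ := S.log.exists_sign (a := c) (b := d) hc0 ht0 ht
  have k0 : k ≠ 0 := by
    rintro rfl; exact Complex.exp_ne_zero _ ((hk c hcc).trans (zero_mul _))
  have A1 := continuousOn_eq_of_exp_eq (f := fun s => Λ t s - L (1, s)) (c := k)
    isPreconnected_Icc ((S.log.cont_Icc hc0 ht0 ht).sub (hLs 1).continuousOn) (fun s hs => by
      have h2 := hL' 1 one_mem s hs
      have h3 : φ s - φ t = Complex.exp (L (1, s)) := by rw [h2]; push_cast; ring
      rw [Complex.exp_sub, hk s hs, h3, mul_div_cancel_right₀ _ (Complex.exp_ne_zero _)]) hdd hcc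
  have A2 := norm_increment_sub_le (F := fun s => L (0, s)) (G := fun s => S.lam (S.π (φ s)))
    (f := fun s => φ s - S.q) (g := fun s => φ (S.π (φ s)) - S.q) (c₁ := 1) (c₂ := 1) hcd.le
    (hLs 0).continuousOn (S.lam_cont.comp (S.π_cont.comp S.cont)).continuousOn
    (fun s hs => by rw [hL' 0 zero_mem s hs]; push_cast; ring)
    (fun s hs => by rw [S.lam_exp _ (S.π_mem _), one_mul])
    (fun s hs => by
      rw [sub_sub_sub_cancel_right]
      linarith [S.track _ (hX.sub hs), S.farq _ (S.π_mem (φ s))])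
  have dif : ∀ (e γ : ℝ), ‖φ e - φ γ‖ ≤ S.δ → ∀ ρ ∈ Set.Icc (0:ℝ) 1,
      ‖φ e - (S.q + ρ * (φ t - S.q)) - (φ γ - (S.q + ρ * (φ S.u₀ - S.q)))‖ ≤ 5 * S.η := by
    intro e γ he ρ hρ
    have : φ e - (S.q + ρ * (φ t - S.q)) - (φ γ - (S.q + ρ * (φ S.u₀ - S.q))) =
      (φ e - φ γ) - ρ * (φ t - φ S.u₀) := by ring
    rw [this]
    refine (norm_sub_le _ _).trans ?_
    rw [norm_mul, Complex.norm_real, Real.norm_of_nonneg hρ.1]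
    have := mul_le_of_le_one_left (norm_nonneg (φ t - φ S.u₀)) hρ.2
    linarith
  have A3 := norm_increment_sub_le (F := fun ρ => L (ρ, d)) (G := S.μβ)
    (f := fun ρ => φ d - (S.q + ρ * (φ t - S.q))) (g := fun ρ => φ S.β - (S.q + ρ * (φ S.u₀ - S.q)))
    (c₁ := 1) (c₂ := 1) zero_le_one (hLr d).continuousOn S.μβ_cont.continuousOn
    (fun ρ hρ => by rw [hL' ρ hρ d hdd, one_mul]) (fun ρ hρ => by rw [S.μβ_exp ρ hρ, one_mul])
    (fun ρ hρ => by linarith [dif d S.β hX.right ρ hρ, S.farμβ ρ hρ])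
  have A4 := norm_increment_sub_le (F := fun ρ => L (ρ, c)) (G := S.μα)
    (f := fun ρ => φ c - (S.q + ρ * (φ t - S.q))) (g := fun ρ => φ S.α - (S.q + ρ * (φ S.u₀ - S.q)))
    (c₁ := 1) (c₂ := 1) zero_le_one (hLr c).continuousOn S.μα_cont.continuousOn
    (fun ρ hρ => by rw [hL' ρ hρ c hcc, one_mul]) (fun ρ hρ => by rw [S.μα_exp ρ hρ, one_mul])
    (fun ρ hρ => by linarith [dif c S.α hX.left ρ hρ, S.farμα ρ hρ])
  have A5 := (S.closeα (φ c) (by linarith [hX.left])).2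
  have A6 := (S.closeβ (φ d) (by linarith [hX.right])).2
  have e : Λ d t - Λ c t - S.g =
      ((L (0, d) - L (0, c)) - (S.lam (S.π (φ d)) - S.lam (S.π (φ c))))
      + ((L (1, d) - L (0, d)) - (S.μβ 1 - S.μβ 0)) - ((L (1, c) - L (0, c)) - (S.μα 1 - S.μα 0))
      + (S.lam (S.π (φ d)) - S.lam S.β) - (S.lam (S.π (φ c)) - S.lam S.α) := by
    rw [g, S.log.symm d t, S.log.symm c t]; linear_combination A1
  rw [e]
  refine (norm_sub_le _ _).trans ?_
  refine (add_le_add_left ((norm_add_le _ _).trans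
    (add_le_add_left ((norm_sub_le _ _).trans (add_le_add_left (norm_add_le _ _) _)) _)) _).trans ?_
  linarith

end Frame

theorem eq_zero_of_exp_eq_one {x : ℂ} (h : Complex.exp x = 1) (hx : ‖x‖ ≤ 3) : x = 0 := by
  obtain ⟨n, rfl⟩ := Complex.exp_eq_one_iff.1 h
  by_contra h0
  have hn : n ≠ 0 := by rintro rfl; simp at h0
  have h1 : (1 : ℝ) ≤ |(n : ℝ)| := by exact_mod_cast Int.one_le_abs hn
  have : ‖(n : ℂ) * (2 * Real.pi * Complex.I)‖ = |(n : ℝ)| * (2 * Real.pi) := by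
    simp [abs_of_pos Real.pi_pos]
  rw [this] at hx
  nlinarith [Real.pi_gt_three]

namespace Frame

variable {φ : ℝ → ℂ} {Λ : ℝ → ℝ → ℂ} (S : Frame φ Λ)

/-- The gap between the two possible sweeps. -/
noncomputable def κ : ℂ := 2 * (S.g - S.h)

lemma exp_g_sub_h : Complex.exp (S.g - S.h) = -1 := by
  have hne1 : φ S.u₀ - φ S.α ≠ 0 := fun h => by
    have := S.farα; rw [h, norm_zero] at this; linarith [S.r_pos]
  have hne2 : φ S.β - φ S.u₀ ≠ 0 := fun h => by
    have := S.farβ; rw [norm_sub_rev, h, norm_zero] at this; linarith [S.r_pos]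
  have one_mem : (1:ℝ) ∈ Set.Icc (0:ℝ) 1 := by simp
  have zero_mem : (0:ℝ) ∈ Set.Icc (0:ℝ) 1 := by simp
  have a := S.α_lt_β.le
  have ex := fun u hu => (S.lam_exp u hu).symm ▸ Complex.exp_ne_zero (S.lam u)
  have h1 := ex S.α ⟨le_rfl, a⟩
  have h2 := ex S.β ⟨a, le_rfl⟩
  simp only [g, h, Complex.exp_sub, Complex.exp_add, S.μα_exp _ one_mem, S.μα_exp _ zero_mem,
    S.μβ_exp _ one_mem, S.μβ_exp _ zero_mem, S.lam_exp S.α ⟨le_rfl, a⟩, S.lam_exp S.β ⟨a, le_rfl⟩,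
    S.log.exp_eq _ _ S.α_nonneg S.α_lt, S.log.exp_eq _ _ S.u₀_nonneg S.lt_β]
  have e1 : φ S.α - (S.q + ((1:ℝ):ℂ) * (φ S.u₀ - S.q)) = -(φ S.u₀ - φ S.α) := by push_cast; ring
  have e2 : φ S.β - (S.q + ((1:ℝ):ℂ) * (φ S.u₀ - S.q)) = φ S.β - φ S.u₀ := by push_cast; ring
  have e3 : φ S.α - (S.q + ((0:ℝ):ℂ) * (φ S.u₀ - S.q)) = φ S.α - S.q := by push_cast; ring
  have e4 : φ S.β - (S.q + ((0:ℝ):ℂ) * (φ S.u₀ - S.q)) = φ S.β - S.q := by push_cast; ring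
  rw [e1, e2, e3, e4]
  generalize φ S.α - S.q = A at *
  generalize φ S.β - S.q = B at *
  generalize φ S.u₀ - φ S.α = C at *
  generalize φ S.β - φ S.u₀ = D at *
  field_simp

lemma exp_κ : Complex.exp S.κ = 1 := by
  rw [κ, two_mul, Complex.exp_add, exp_g_sub_h]; norm_num

lemma κ_ne_zero : S.κ ≠ 0 := by
  intro h
  have h1 : S.g - S.h = 0 := by simpa [κ] using h
  have := S.exp_g_sub_h
  rw [h1, Complex.exp_zero] at this
  norm_num at this

lemma κ_norm : 3 < ‖S.κ‖ := by
  by_contra! h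
  exact S.κ_ne_zero (eq_zero_of_exp_eq_one S.exp_κ h)

/-- The strand `[c, d]` is met before the strand `[c', d']`. -/
def First (c d c' d' : ℝ) : Prop :=
  (∀ t ∈ Set.Icc c d, S.Near t → ‖Λ d' t - Λ c' t - S.g‖ ≤ 1) ∧
  (∀ s ∈ Set.Icc c' d', S.Near s → ‖Λ d s - Λ c s - (S.g - S.κ)‖ ≤ 1)

lemma exists_Near {c d : ℝ} (hX : S.Strand c d) : ∃ t ∈ Set.Icc c d, S.Near t := by
  obtain ⟨t, ht, h⟩ := S.exists_near hX
  exact ⟨t, ht, h.trans (by linarith [S.η_pos])⟩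

lemma first_of_sweep {c d c' d' t : ℝ} (hX : S.Strand c d) (hY : S.Strand c' d')
    (hd : d < c' ∨ d' < c) (ht : t ∈ Set.Icc c d) (hn : S.Near t)
    (h : ‖Λ d' t - Λ c' t - S.g‖ ≤ 6 / 100) : S.First c d c' d' := by
  have key : ∀ s ∈ Set.Icc c' d', S.Near s → ‖Λ d s - Λ c s - (S.g - S.κ)‖ ≤ 18 / 100 := by
    intro s hs hns
    have h1 := S.sweep_add_sweep hY hX hd.symm hs ht hns hn
    have e : Λ d s - Λ c s - (S.g - S.κ) =
      ((Λ d' t - Λ c' t) + (Λ d s - Λ c s) - 2 * S.h) - (Λ d' t - Λ c' t - S.g) := by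
      rw [κ]; ring
    rw [e]
    exact (norm_sub_le _ _).trans (by linarith)
  refine ⟨fun t' ht' hn' => ?_, fun s hs hns => (key s hs hns).trans (by norm_num)⟩
  obtain ⟨s, hs, hns⟩ := S.exists_Near hY
  have h1 := S.sweep_add_sweep hY hX hd.symm hs ht' hns hn'
  have e : Λ d' t' - Λ c' t' - S.g =
      ((Λ d' t' - Λ c' t') + (Λ d s - Λ c s) - 2 * S.h) - (Λ d s - Λ c s - (S.g - S.κ)) := by
      rw [κ]; ring
  rw [e]
  exact (norm_sub_le _ _).trans (by linarith [key s hs hns])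

lemma exists_first {ι : Type*} [Finite ι] [Nonempty ι] {c d : ι → ℝ}
    (hX : ∀ i, S.Strand (c i) (d i))
    (hd : ∀ i j, i ≠ j → d i < c j ∨ d j < c i) :
    ∃ i, ∀ j, j ≠ i → S.First (c i) (d i) (c j) (d j) := by
  obtain ⟨i, t, ht, hn, h⟩ := S.exists_first_touch hX
  refine ⟨i, fun j hj => S.first_of_sweep (hX i) (hX j) (hd i j hj.symm) ht hn ?_⟩
  refine S.sweep_of_touch (hX j) ((hX i).nonneg.trans ht.1) ?_ hn (h j)
  exact (hd j i hj).symm.imp (fun h => ht.2.trans_lt h) (fun h => h.trans_le ht.1)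

lemma first_or_first {c d c' d' : ℝ} (hX : S.Strand c d) (hY : S.Strand c' d')
    (hd : d < c' ∨ d' < c) : S.First c d c' d' ∨ S.First c' d' c d := by
  obtain ⟨i, hi⟩ := S.exists_first (c := ![c, c']) (d := ![d, d'])
    (by intro i; fin_cases i <;> simpa) (by
      intro i j hij; fin_cases i <;> fin_cases j <;> simp at hij ⊢
      · exact hd
      · exact hd.symm)
  fin_cases i
  · exact Or.inl (by simpa using hi 1 (by simp))
  · exact Or.inr (by simpa using hi 0 (by simp))

lemma first_triple {c₁ d₁ c₂ d₂ c₃ d₃ : ℝ} (h1 : S.Strand c₁ d₁) (h2 : S.Strand c₂ d₂)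
    (h3 : S.Strand c₃ d₃) (h12 : d₁ < c₂) (h23 : d₂ < c₃) :
    (S.First c₁ d₁ c₂ d₂ ∧ S.First c₁ d₁ c₃ d₃) ∨ (S.First c₂ d₂ c₁ d₁ ∧ S.First c₂ d₂ c₃ d₃) ∨
    (S.First c₃ d₃ c₁ d₁ ∧ S.First c₃ d₃ c₂ d₂) := by
  have h13 : d₁ < c₃ := h12.trans (h2.lt.trans h23)
  obtain ⟨i, hi⟩ := S.exists_first (c := ![c₁, c₂, c₃]) (d := ![d₁, d₂, d₃])
    (by intro i; fin_cases i <;> simpa) (by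
      intro i j hij; fin_cases i <;> fin_cases j <;> simp at hij ⊢ <;> tauto)
  fin_cases i
  · exact Or.inl ⟨by simpa using hi 1 (by simp), by simpa using hi 2 (by simp)⟩
  · exact Or.inr (Or.inl ⟨by simpa using hi 0 (by simp), by simpa using hi 2 (by simp)⟩)
  · exact Or.inr (Or.inr ⟨by simpa using hi 0 (by simp), by simpa using hi 1 (by simp)⟩)

lemma norm_gap_le {a b : ℂ} {x y : ℝ} (h1 : ‖a - S.g‖ ≤ x) (h2 : ‖b - (S.g - S.κ)‖ ≤ y) :
    3 < x + y + ‖a - b‖ := by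
  have e : S.κ = (b - (S.g - S.κ)) - (a - S.g) + (a - b) := by ring
  have := S.κ_norm
  rw [e] at this
  have h3 := norm_add_le ((b - (S.g - S.κ)) - (a - S.g)) (a - b)
  have h4 := norm_sub_le (b - (S.g - S.κ)) (a - S.g)
  linarith

lemma First.not_first {c d c' d' : ℝ} (hX : S.Strand c d)
    (h : S.First c d c' d') : ¬ S.First c' d' c d := by
  intro h'
  obtain ⟨t, ht, hn⟩ := S.exists_Near hX
  have := S.norm_gap_le (h.1 t ht hn) (h'.2 t ht hn)
  rw [sub_self, norm_zero] at this
  linarith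

/-- `p` is a time at which the path closely repeats the arc. -/
structure Ret (p : ℝ) : Prop where
  lt : S.β < p + S.α
  close : ∀ u ∈ Set.Icc S.α S.β, ‖φ (p + u) - φ u‖ ≤ S.δ / 1000

lemma strand_self : S.Strand S.α S.β where
  nonneg := S.α_nonneg
  lt := S.α_lt_β
  left := by simpa using S.δ_pos.le
  right := by simpa using S.δ_pos.le
  sub := fun t ht => by
    have : Metric.infDist (φ t) S.arc = 0 := Metric.infDist_zero_of_mem ⟨t, ht, rfl⟩
    exact this.le.trans S.δ_pos.le

lemma α_mem : S.α ∈ Set.Icc S.α S.β := ⟨le_rfl, S.α_lt_β.le⟩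

lemma β_mem : S.β ∈ Set.Icc S.α S.β := ⟨S.α_lt_β.le, le_rfl⟩

variable {S}

lemma Ret.pos {p : ℝ} (hp : S.Ret p) : 0 < p := by linarith [hp.lt, S.α_lt_β]

lemma Ret.strand {p : ℝ} (hp : S.Ret p) : S.Strand (p + S.α) (p + S.β) where
  nonneg := add_nonneg hp.pos.le S.α_nonneg
  lt := by linarith [S.α_lt_β]
  left := (hp.close _ S.α_mem).trans (by linarith [S.δ_pos])
  right := (hp.close _ S.β_mem).trans (by linarith [S.δ_pos])
  sub := fun t ht => by
    have h1 : t - p ∈ Set.Icc S.α S.β := ⟨by linarith [ht.1], by linarith [ht.2]⟩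
    have h2 := hp.close _ h1
    rw [add_sub_cancel] at h2
    have : Metric.infDist (φ t) S.arc ≤ dist (φ t) (φ (t - p)) :=
      Metric.infDist_le_dist_of_mem ⟨_, h1, rfl⟩
    rw [dist_eq_norm] at this
    exact this.trans (h2.trans (by linarith [S.δ_pos]))

variable (S)

/-- The winding discrepancy between the arc and its repetition, seen from time `t`. -/
noncomputable def W (_ : Frame φ Λ) (p t u : ℝ) : ℂ :=
  Λ (p + u) t - Λ u t - Complex.log ((φ (p + u) - φ t) / (φ u - φ t))

variable {S} {p : ℝ}

lemma ne_of_lt {s t : ℝ} (S : Frame φ Λ) (hs : 0 ≤ s) (hst : s < t) : φ s - φ t ≠ 0 := fun h =>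
  hst.ne (S.inj (Set.mem_Ici.2 hs) (Set.mem_Ici.2 (hs.trans hst.le)) (sub_eq_zero.1 h))

lemma Ret.lt_of_mem (hp : S.Ret p) {t u : ℝ} (hu : u ∈ Set.Icc S.α S.β) (ht : p + S.β < t) :
    0 ≤ u ∧ 0 ≤ p + u ∧ u < t ∧ p + u < t := by
  have := hp.pos
  have := S.α_nonneg
  refine ⟨?_, ?_, ?_, ?_⟩ <;> linarith [hu.1, hu.2]

lemma Ret.exp_W (hp : S.Ret p) {t u : ℝ} (hu : u ∈ Set.Icc S.α S.β) (ht : p + S.β < t) :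
    Complex.exp (S.W p t u) = 1 := by
  obtain ⟨h1, h2, h3, h4⟩ := hp.lt_of_mem hu ht
  have n1 := S.ne_of_lt h1 h3
  have n2 := S.ne_of_lt h2 h4
  have n3 : φ t - φ u ≠ 0 := by rw [← neg_sub]; exact neg_ne_zero.2 n1
  rw [W, Complex.exp_sub, Complex.exp_sub, Complex.exp_log (div_ne_zero n2 n1),
    S.log.exp_eq _ _ h1 h3, S.log.exp_eq _ _ h2 h4, ← neg_sub (φ (p + u)), ← neg_sub (φ u)]
  field_simp

lemma Ret.W_eq_of_far (hp : S.Ret p) {u a b : ℝ} (hu : u ∈ Set.Icc S.α S.β) (ha : p + S.β < a)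
    (hab : a ≤ b) (h : ∀ t ∈ Set.Icc a b, S.δ / 2 < ‖φ t - φ u‖) : S.W p a u = S.W p b u := by
  refine continuousOn_eq_of_exp_eq (f := fun t => S.W p t u) (c := 1) isPreconnected_Icc
    ?_ (fun t ht => hp.exp_W hu (ha.trans_le ht.1)) ⟨le_rfl, hab⟩ ⟨hab, le_rfl⟩
  obtain ⟨h1, h2, h3, h4⟩ := hp.lt_of_mem hu ha
  have hφ := S.cont
  refine ((S.log.cont_Icc (h1.trans h3.le) h2 (Or.inl h4)).sub
    (S.log.cont_Icc (h1.trans h3.le) h1 (Or.inl h3))).sub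
    (continuousOn_log_div (by fun_prop) (by fun_prop)
      (fun t ht => S.ne_of_lt h1 (h3.trans_le ht.1)) (fun t ht => ?_))
  rw [sub_sub_sub_cancel_right, norm_sub_rev (φ u)]
  linarith [hp.close u hu, h t ht, S.δ_pos]

lemma dist_of_not_mem_tube {t u : ℝ} (ht : t ∉ S.tube) (hu : u ∈ Set.Icc S.α S.β) :
    S.δ < ‖φ t - φ u‖ := by
  have h1 : S.δ < Metric.infDist (φ t) S.arc := not_le.1 ht
  have h2 : Metric.infDist (φ t) S.arc ≤ dist (φ t) (φ u) :=
    Metric.infDist_le_dist_of_mem ⟨_, hu, rfl⟩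
  rw [dist_eq_norm] at h2
  linarith

lemma Ret.W_eq_of_clean (hp : S.Ret p) {t : ℝ} (ht : p + S.β < t) (hc : t ∉ S.tube) :
    S.W p t S.α = S.W p t S.β := by
  refine continuousOn_eq_of_exp_eq (f := fun u => S.W p t u) (c := 1) isPreconnected_Icc
    ?_ (fun u hu => hp.exp_W hu ht) S.α_mem S.β_mem
  have hφ := S.cont
  have h0 : 0 ≤ t := by linarith [hp.pos, S.β_nonneg]
  have hβt : S.β < t := by linarith [hp.pos]
  refine ContinuousOn.sub (ContinuousOn.sub ?_ ?_) ?_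
  · have := S.log.cont_Icc (a := p + S.α) (b := p + S.β) hp.strand.nonneg h0 (Or.inr ht)
    refine (this.comp (f := fun u => p + u) (s := Set.Icc S.α S.β) (by fun_prop)
      (fun u hu => ⟨by linarith [hu.1], by linarith [hu.2]⟩)).congr fun u _ => ?_
    exact S.log.symm _ _
  · exact (S.log.cont_Icc S.α_nonneg h0 (Or.inr hβt)).congr fun u _ => S.log.symm _ _
  · refine continuousOn_log_div (f := fun u => φ (p + u) - φ t) (g := fun u => φ u - φ t)
      (by fun_prop) (by fun_prop)
      (fun u hu => S.ne_of_lt (S.α_nonneg.trans hu.1) (hu.2.trans_lt hβt)) (fun u hu => ?_)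
    rw [sub_sub_sub_cancel_right, norm_sub_rev (φ u) (φ t)]
    linarith [hp.close u hu, dist_of_not_mem_tube hc hu, S.δ_pos]

/-- The jump of the winding discrepancy along a strand. -/
lemma Ret.jump_approx (hp : S.Ret p) {t : ℝ} (ht : p + S.β < t) (hn : S.Near t) :
    ‖(S.W p t S.α - S.W p t S.β) -
      ((Λ S.β t - Λ S.α t) - (Λ (p + S.β) t - Λ (p + S.α) t))‖ ≤ 1 / 100 := by
  have hδ := S.δ_le
  have hη := S.η_le
  have hd := S.δ_pos
  have close : ∀ u ∈ Set.Icc S.α S.β, S.r < ‖φ t - φ u‖ →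
      ‖Complex.log ((φ (p + u) - φ t) / (φ u - φ t))‖ ≤ 1 / 200 := fun u hu hr => by
    obtain ⟨h1, h2, h3, h4⟩ := hp.lt_of_mem hu ht
    refine norm_log_div_le (S.ne_of_lt h1 h3) ?_
    rw [sub_sub_sub_cancel_right, norm_sub_rev (φ u)]
    linarith [hp.close u hu]
  have h1 := close S.α S.α_mem (S.near_far_α hn)
  have h2 := close S.β S.β_mem (S.near_far_β hn)
  have e : (S.W p t S.α - S.W p t S.β) -
      ((Λ S.β t - Λ S.α t) - (Λ (p + S.β) t - Λ (p + S.α) t)) =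
      Complex.log ((φ (p + S.β) - φ t) / (φ S.β - φ t)) -
      Complex.log ((φ (p + S.α) - φ t) / (φ S.α - φ t)) := by
    rw [W, W]; ring
  rw [e]
  exact (norm_sub_le _ _).trans (by linarith)

lemma Ret.jump_eq (hp : S.Ret p) {t : ℝ} (ht : p + S.β < t) (hn : S.Near t) {x y z : ℂ}
    (hx : ‖Λ S.β t - Λ S.α t - x‖ ≤ 1) (hy : ‖Λ (p + S.β) t - Λ (p + S.α) t - y‖ ≤ 1)
    (hxy : x - y = z) (hz : Complex.exp z = 1) : S.W p t S.α - S.W p t S.β = z := by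
  rw [← sub_eq_zero]
  refine eq_zero_of_exp_eq_one ?_ ?_
  · rw [Complex.exp_sub, Complex.exp_sub, hp.exp_W S.α_mem ht, hp.exp_W S.β_mem ht, hz]; norm_num
  · have h := hp.jump_approx ht hn
    have e : S.W p t S.α - S.W p t S.β - z = (S.W p t S.α - S.W p t S.β -
      ((Λ S.β t - Λ S.α t) - (Λ (p + S.β) t - Λ (p + S.α) t)))
      + ((Λ S.β t - Λ S.α t - x) - (Λ (p + S.β) t - Λ (p + S.α) t - y)) := by rw [← hxy]; ring
    rw [e]
    refine (norm_add_le _ _).trans ?_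
    have := norm_sub_le (Λ S.β t - Λ S.α t - x) (Λ (p + S.β) t - Λ (p + S.α) t - y)
    linarith

lemma Ret.jump_cases_of_first (hp : S.Ret p) (hf : S.First (p + S.α) (p + S.β) S.α S.β)
    {c d t : ℝ} (hX : S.Strand c d) (hc : p + S.β < c) (ht : t ∈ Set.Icc c d) (hn : S.Near t) :
    S.W p t S.α - S.W p t S.β = 0 ∨ S.W p t S.α - S.W p t S.β = S.κ := by
  have ht' := hc.trans_le ht.1
  rcases S.first_triple S.strand_self hp.strand hX hp.lt hc with h | h | h
  · exact absurd h.1 (hf.not_first S hp.strand)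
  · rcases S.first_or_first S.strand_self hX (Or.inl (by linarith [hp.pos])) with h' | h'
    · exact Or.inl (hp.jump_eq ht' hn (h'.2 t ht hn) (h.2.2 t ht hn) (sub_self _) Complex.exp_zero)
    · exact Or.inr (hp.jump_eq ht' hn (h'.1 t ht hn) (h.2.2 t ht hn) (by ring) S.exp_κ)
  · exact Or.inl (hp.jump_eq ht' hn (h.1.1 t ht hn) (h.2.1 t ht hn) (sub_self _) Complex.exp_zero)

lemma exp_neg_κ : Complex.exp (-S.κ) = 1 := by rw [Complex.exp_neg, S.exp_κ, inv_one]

lemma Ret.jump_cases_of_second (hp : S.Ret p) (hf : S.First S.α S.β (p + S.α) (p + S.β))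
    {c d t : ℝ} (hX : S.Strand c d) (hc : p + S.β < c) (ht : t ∈ Set.Icc c d) (hn : S.Near t) :
    S.W p t S.α - S.W p t S.β = 0 ∨ S.W p t S.α - S.W p t S.β = -S.κ := by
  have ht' := hc.trans_le ht.1
  rcases S.first_triple S.strand_self hp.strand hX hp.lt hc with h | h | h
  · rcases S.first_or_first hp.strand hX (Or.inl hc) with h' | h'
    · exact Or.inl (hp.jump_eq ht' hn (h.2.2 t ht hn) (h'.2 t ht hn) (sub_self _) Complex.exp_zero)
    · exact Or.inr (hp.jump_eq ht' hn (h.2.2 t ht hn) (h'.1 t ht hn) (by ring) exp_neg_κ)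
  · exact absurd h.1 (hf.not_first S S.strand_self)
  · exact Or.inl (hp.jump_eq ht' hn (h.1.1 t ht hn) (h.2.1 t ht hn) (sub_self _) Complex.exp_zero)

end Frame

namespace Frame

variable {φ : ℝ → ℂ} {Λ : ℝ → ℝ → ℂ} {S : Frame φ Λ} {p : ℝ}

/-- The change of the winding discrepancy during an excursion into the tube. -/
lemma Ret.excursion (hp : S.Ret p) {a b e₁ e₂ : ℝ} (hpa : p + S.β < a) (hab : a ≤ b)
    (ha : a ∉ S.tube) (hb : b ∉ S.tube) (he : Set.Icc e₁ e₂ ⊆ S.tube)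
    (hα : ∀ x ∈ Set.Icc a b, ‖φ x - φ S.α‖ ≤ S.δ / 2 → x ∈ Set.Icc e₁ e₂)
    (hβ : ∀ x ∈ Set.Icc a b, ‖φ x - φ S.β‖ ≤ S.δ / 2 → x ∈ Set.Icc e₁ e₂) :
    (S.W p b S.α = S.W p a S.α ∧ ¬((∃ x ∈ Set.Icc a b, ‖φ x - φ S.α‖ ≤ S.δ / 2) ∧
      ∃ x ∈ Set.Icc a b, ‖φ x - φ S.β‖ ≤ S.δ / 2)) ∨
    ∃ c d, S.Strand c d ∧ a ≤ c ∧ d ≤ b ∧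
      (∀ x ∈ Set.Icc a b, ‖φ x - φ S.α‖ ≤ S.δ / 2 → x ≤ c) ∧
      (∀ x ∈ Set.Icc a b, ‖φ x - φ S.β‖ ≤ S.δ / 2 → d ≤ x) ∧
      ∃ t ∈ Set.Icc c d, S.Near t ∧ S.W p b S.α - S.W p a S.α = S.W p t S.α - S.W p t S.β := by
  have hδ := S.δ_pos
  have hδη := S.δ_le
  have hηr := S.η_le
  have a0 : 0 ≤ a := by linarith [hp.pos, S.β_nonneg]
  by_cases h1 : ∃ x ∈ Set.Icc a b, ‖φ x - φ S.α‖ ≤ S.δ / 2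
  swap
  · push Not at h1
    exact Or.inl ⟨(hp.W_eq_of_far S.α_mem hpa hab h1).symm, fun ⟨⟨x, hx, h⟩, _⟩ =>
      absurd h (not_le.2 (h1 x hx))⟩
  by_cases h2 : ∃ x ∈ Set.Icc a b, ‖φ x - φ S.β‖ ≤ S.δ / 2
  swap
  · push Not at h2
    refine Or.inl ⟨?_, fun ⟨_, x, hx, h⟩ => absurd h (not_le.2 (h2 x hx))⟩
    rw [hp.W_eq_of_clean hpa ha, hp.W_eq_of_clean (hpa.trans_le hab) hb,
      hp.W_eq_of_far S.β_mem hpa hab h2]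
  right
  have hφ := S.cont
  have hcl : ∀ u, IsCompact (Set.Icc a b ∩ {x | ‖φ x - φ u‖ ≤ S.δ / 2}) := fun u =>
    isCompact_Icc.inter_right (isClosed_le (by fun_prop) continuous_const)
  obtain ⟨c, ⟨hcI, hcα⟩, hcmax⟩ := (hcl S.α).exists_isGreatest h1
  obtain ⟨d, ⟨hdI, hdβ⟩, hdmin⟩ := (hcl S.β).exists_isLeast h2
  have hcα' : ‖φ c - φ S.α‖ ≤ S.δ / 2 := hcα
  have hdβ' : ‖φ d - φ S.β‖ ≤ S.δ / 2 := hdβ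
  have hce := hα c hcI hcα
  have hde := hβ d hdI hdβ
  have hcd : c < d := by
    rcases lt_trichotomy c d with h | h | h
    · exact h
    · exfalso
      subst h
      have := norm_sub_le_norm_sub_add_norm_sub (φ S.α) (φ c) (φ S.β)
      rw [norm_sub_rev (φ S.α) (φ c)] at this
      linarith [S.farαβ]
    · exact absurd ((Set.Icc_subset_Icc hde.1 hce.2).trans he)
        (S.noreverse S.α S.β (by simp) (by simp) S.α_lt_β d c (a0.trans hdI.1) h
          (by linarith) (by linarith))
  have hX : S.Strand c d := ⟨a0.trans hcI.1, hcd, by linarith, by linarith,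
    (Set.Icc_subset_Icc hce.1 hde.2).trans he⟩
  obtain ⟨t, ht, hn⟩ := S.exists_Near hX
  refine ⟨c, d, hX, hcI.1, hdI.2, fun x hx h => hcmax ⟨hx, h⟩, fun x hx h => hdmin ⟨hx, h⟩,
    t, ht, hn, ?_⟩
  have hct : c < t := lt_of_le_of_ne ht.1 (by
    rintro rfl; linarith [S.near_far_α hn])
  have htd : t < d := lt_of_le_of_ne ht.2 (by
    rintro rfl; linarith [S.near_far_β hn])
  have e1 : S.W p t S.α = S.W p b S.α := by
    refine hp.W_eq_of_far S.α_mem (by linarith [hcI.1]) (by linarith [hdI.2]) fun x hx => ?_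
    by_contra! h
    have := hcmax ⟨⟨by linarith [hcI.1, hx.1], hx.2⟩, h⟩
    linarith [hx.1]
  have e2 : S.W p a S.β = S.W p t S.β := by
    refine hp.W_eq_of_far S.β_mem hpa (by linarith [hcI.1]) fun x hx => ?_
    by_contra! h
    have := hdmin ⟨⟨hx.1, by linarith [hdI.2, hx.2]⟩, h⟩
    linarith [hx.2]
  rw [e1, ← e2, hp.W_eq_of_clean hpa ha]

lemma isClosed_tube (S : Frame φ Λ) : IsClosed S.tube :=
  isClosed_le ((Metric.continuous_infDist_pt _).comp S.cont) continuous_const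

/-- A maximal excursion into the tube around a given time. -/
lemma exists_excursion (S : Frame φ Λ) {a x b : ℝ} (ha : a ∉ S.tube) (hb : b ∉ S.tube)
    (hx : x ∈ S.tube) (hax : a ≤ x) (hxb : x ≤ b) :
    ∃ e₁ e₂, e₁ ≤ x ∧ x ≤ e₂ ∧ Set.Icc e₁ e₂ ⊆ S.tube ∧ a < e₁ ∧ e₂ < b ∧ ∃ ε > 0,
      (∀ y, e₁ - ε < y → y < e₂ + ε → ∀ u ∈ Set.Icc S.α S.β, ‖φ y - φ u‖ ≤ S.δ / 2 →
        y ∈ Set.Icc e₁ e₂) ∧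
      (∃ r, a ≤ r ∧ e₁ - ε < r ∧ r < e₁ ∧ r ∉ S.tube) ∧
      (∃ r, r ≤ b ∧ e₂ < r ∧ r < e₂ + ε ∧ r ∉ S.tube) := by
  let L : Set ℝ := {y | y ∉ S.tube ∧ y ≤ x}
  let R : Set ℝ := {y | y ∉ S.tube ∧ x ≤ y}
  have hop : IsOpen (S.tubeᶜ) := S.isClosed_tube.isOpen_compl
  have hLb : BddAbove L := ⟨x, fun y h => h.2⟩
  have hRb : BddBelow R := ⟨x, fun y h => h.2⟩
  have haL : a ∈ L := ⟨ha, hax⟩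
  have hbR : b ∈ R := ⟨hb, hxb⟩
  set e₁ := sSup L with he₁
  set e₂ := sInf R with he₂
  have hL : IsLUB L e₁ := isLUB_csSup ⟨a, haL⟩ hLb
  have hR : IsGLB R e₂ := isGLB_csInf ⟨b, hbR⟩ hRb
  have h1x : e₁ ≤ x := hL.2 fun y h => h.2
  have hx2 : x ≤ e₂ := hR.2 fun y h => h.2
  have h1t : e₁ ∈ S.tube := by
    by_contra h
    obtain ⟨ε, hε, hball⟩ := Metric.isOpen_iff.1 hop e₁ h
    have hlt : e₁ < x := lt_of_le_of_ne h1x (fun e => h (e ▸ hx))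
    have hm : min x (e₁ + ε / 2) ∈ L := by
      refine ⟨hball ?_, min_le_left _ _⟩
      rw [Metric.mem_ball, Real.dist_eq, abs_of_nonneg (by
        rw [sub_nonneg]; exact le_min h1x (by linarith))]
      linarith [min_le_right x (e₁ + ε / 2)]
    have := hL.1 hm
    exact absurd this (not_le.2 (lt_min hlt (by linarith)))
  have h2t : e₂ ∈ S.tube := by
    by_contra h
    obtain ⟨ε, hε, hball⟩ := Metric.isOpen_iff.1 hop e₂ h
    have hlt : x < e₂ := lt_of_le_of_ne hx2 (fun e => h (e ▸ hx))
    have hm : max x (e₂ - ε / 2) ∈ R := by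
      refine ⟨hball ?_, le_max_left _ _⟩
      rw [Metric.mem_ball, Real.dist_eq, abs_sub_comm, abs_of_nonneg (by
        rw [sub_nonneg]; exact max_le hx2 (by linarith))]
      linarith [le_max_right x (e₂ - ε / 2)]
    have := hR.1 hm
    exact absurd this (not_le.2 (max_lt hlt (by linarith)))
  have htube : Set.Icc e₁ e₂ ⊆ S.tube := by
    intro y hy
    by_contra h
    rcases le_total y x with hyx | hyx
    · have := hL.1 (show y ∈ L from ⟨h, hyx⟩)
      exact h (le_antisymm hy.1 this ▸ h1t)
    · have := hR.1 (show y ∈ R from ⟨h, hyx⟩)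
      exact h (le_antisymm this hy.2 ▸ h2t)
  have ha1 : a < e₁ := lt_of_le_of_ne (hL.1 haL) (fun e => ha (e ▸ h1t))
  have hb2 : e₂ < b := lt_of_le_of_ne (hR.1 hbR) (fun e => hb (e ▸ h2t))
  have hδ := S.δ_pos
  have hcont : Continuous fun y => Metric.infDist (φ y) S.arc :=
    (Metric.continuous_infDist_pt _).comp S.cont
  have cl : ∀ y, y ∈ closure (S.tubeᶜ) → ∀ᶠ z in 𝓝 y, S.δ / 2 < Metric.infDist (φ z) S.arc := by
    intro y hy
    have : S.δ ≤ Metric.infDist (φ y) S.arc := by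
      have hcl : IsClosed {y | S.δ ≤ Metric.infDist (φ y) S.arc} :=
        isClosed_le continuous_const hcont
      refine hcl.closure_subset_iff.2 (fun z hz => ?_) hy
      have hz' : ¬ Metric.infDist (φ z) S.arc ≤ S.δ := hz
      exact (not_le.1 hz').le
    exact hcont.continuousAt.eventually_const_lt (by linarith)
  have c1 : e₁ ∈ closure (S.tubeᶜ) :=
    closure_mono (fun y h => h.1) (hL.mem_closure ⟨a, haL⟩)
  have c2 : e₂ ∈ closure (S.tubeᶜ) :=
    closure_mono (fun y h => h.1) (hR.mem_closure ⟨b, hbR⟩)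
  obtain ⟨ε₁, hε₁, hb1⟩ := Metric.eventually_nhds_iff.1 (cl e₁ c1)
  obtain ⟨ε₂, hε₂, hb2'⟩ := Metric.eventually_nhds_iff.1 (cl e₂ c2)
  refine ⟨e₁, e₂, h1x, hx2, htube, ha1, hb2, min ε₁ ε₂, lt_min hε₁ hε₂, ?_, ?_, ?_⟩
  · intro y hy1 hy2 u hu hyu
    have hle : Metric.infDist (φ y) S.arc ≤ S.δ / 2 := by
      refine (Metric.infDist_le_dist_of_mem (Set.mem_image_of_mem φ hu)).trans ?_
      rwa [dist_eq_norm]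
    by_contra h
    rw [Set.mem_Icc, not_and_or, not_le, not_le] at h
    rcases h with h | h
    · refine absurd (hb1 (y := y) ?_) (not_lt.2 hle)
      rw [Real.dist_eq, abs_sub_comm, abs_of_pos (by linarith)]
      linarith [min_le_left ε₁ ε₂]
    · refine absurd (hb2' (y := y) ?_) (not_lt.2 hle)
      rw [Real.dist_eq, abs_of_pos (by linarith)]
      linarith [min_le_right ε₁ ε₂]
  · have hlt : max a (e₁ - min ε₁ ε₂) < e₁ := max_lt ha1 (by linarith [lt_min hε₁ hε₂])
    obtain ⟨r, hr, h⟩ := (lt_isLUB_iff hL).1 hlt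
    exact ⟨r, (le_max_left _ _).trans h.le, (le_max_right _ _).trans_lt h,
      lt_of_le_of_ne (hL.1 hr) (fun e => hr.1 (e ▸ h1t)), hr.1⟩
  · have hlt : e₂ < min b (e₂ + min ε₁ ε₂) := lt_min hb2 (by linarith [lt_min hε₁ hε₂])
    obtain ⟨r, hr, h⟩ := (isGLB_lt_iff hR).1 hlt
    exact ⟨r, h.le.trans (min_le_left _ _),
      lt_of_le_of_ne (hR.1 hr) (fun e => hr.1 (e ▸ h2t)), h.trans_le (min_le_right _ _), hr.1⟩

lemma re_div_mono {z w k : ℂ} (h : w - z = 0 ∨ w - z = k) : (z / k).re ≤ (w / k).re := by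
  rcases h with h | h
  · rw [sub_eq_zero.1 h]
  · have : w / k = z / k + k / k := by rw [← add_div, ← h]; ring
    rw [this, Complex.add_re]
    by_cases hk : k = 0
    · simp [hk]
    · rw [div_self hk]; simp

/-- The winding discrepancy is monotone along clean times. -/
lemma Ret.mono (hp : S.Ret p) {k : ℂ}
    (hk : ∀ c d, S.Strand c d → p + S.β < c → ∀ t ∈ Set.Icc c d, S.Near t →
      S.W p t S.α - S.W p t S.β = 0 ∨ S.W p t S.α - S.W p t S.β = k)
    {a b : ℝ} (hpa : p + S.β < a) (hab : a ≤ b) (ha : a ∉ S.tube) (hb : b ∉ S.tube) :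
    (S.W p a S.α / k).re ≤ (S.W p b S.α / k).re := by
  set ω : ℝ → ℝ := fun t => (S.W p t S.α / k).re with hω
  let T : Set ℝ := {t | t ∉ S.tube ∧ t ∈ Set.Icc a b ∧ ω a ≤ ω t}
  have haT : a ∈ T := ⟨ha, ⟨le_rfl, hab⟩, le_rfl⟩
  have hTb : BddAbove T := ⟨b, fun t h => h.2.1.2⟩
  set c := sSup T
  have hc : IsLUB T c := isLUB_csSup ⟨a, haT⟩ hTb
  have hac : a ≤ c := hc.1 haT
  have hcb : c ≤ b := hc.2 fun t h => h.2.1.2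
  have hδ := S.δ_pos
  by_cases hct : c ∈ S.tube
  · exfalso
    obtain ⟨e₁, e₂, h1, h2, ht, ha1, hb2, ε, hε, hhit, -, r', hr'b, hr'1, hr'2, hr't⟩ :=
      S.exists_excursion ha hb hct hac hcb
    obtain ⟨r, hrT, hr⟩ := (lt_isLUB_iff hc).1 (show e₁ - ε < c by linarith)
    have hrc := hc.1 hrT
    have hre : r < e₁ := by
      by_contra! h
      exact hrT.1 (ht ⟨h, hrc.trans h2⟩)
    have hpr : p + S.β < r := hpa.trans_le hrT.2.1.1
    have hx := hp.excursion hpr (by linarith) hrT.1 hr't ht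
      (fun x hx => hhit x (by linarith [hx.1]) (by linarith [hx.2]) _ S.α_mem)
      (fun x hx => hhit x (by linarith [hx.1]) (by linarith [hx.2]) _ S.β_mem)
    have : ω r ≤ ω r' := by
      rcases hx with ⟨h, -⟩ | ⟨c', d', hX, hc', hd', -, -, t, ht', hn, h⟩
      · exact re_div_mono (Or.inl (sub_eq_zero.2 h))
      · refine re_div_mono ?_
        rw [h]
        exact hk c' d' hX (hpr.trans_le hc') t ht' hn
    have hr'T : r' ∈ T := ⟨hr't, ⟨by linarith, hr'b⟩, hrT.2.2.trans this⟩
    linarith [hc.1 hr'T]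
  · have hop : IsOpen (S.tubeᶜ) := S.isClosed_tube.isOpen_compl
    obtain ⟨ε, hε, hball⟩ := Metric.isOpen_iff.1 hop c hct
    have key : ∀ x y, c - ε < x → x ≤ y → y < c + ε → p + S.β < x →
        S.W p x S.α = S.W p y S.α := by
      intro x y hx hxy hy hpx
      refine hp.W_eq_of_far S.α_mem hpx hxy fun t ht => ?_
      have : t ∉ S.tube := hball (by
        rw [Metric.mem_ball, Real.dist_eq, abs_lt]; constructor <;> linarith [ht.1, ht.2])
      linarith [dist_of_not_mem_tube this S.α_mem]
    obtain ⟨r, hrT, hr⟩ := (lt_isLUB_iff hc).1 (show c - ε < c by linarith)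
    have hrc := hc.1 hrT
    have hpr : p + S.β < r := hpa.trans_le hrT.2.1.1
    by_cases hcb' : b < c + ε
    · have := key r b hr (hrc.trans hcb) hcb' hpr
      exact hrT.2.2.trans (by simp only [hω]; rw [this])
    · exfalso
      have hm : c + ε / 2 ∈ T := by
        refine ⟨hball ?_, ⟨by linarith, by linarith⟩, hrT.2.2.trans ?_⟩
        · rw [Metric.mem_ball, Real.dist_eq, abs_lt]; constructor <;> linarith
        · simp only [hω]; rw [key r (c + ε / 2) hr (by linarith) (by linarith) hpr]
      linarith [hc.1 hm]

/-- A strand along which the winding discrepancy jumps prevents its return. -/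
lemma Ret.W_ne_of_jump (hp : S.Ret p) {k : ℂ} (hk0 : k ≠ 0)
    (hk : ∀ c d, S.Strand c d → p + S.β < c → ∀ t ∈ Set.Icc c d, S.Near t →
      S.W p t S.α - S.W p t S.β = 0 ∨ S.W p t S.α - S.W p t S.β = k)
    {c d : ℝ} (hX : S.Strand c d) (hc : ‖φ c - φ S.α‖ ≤ S.δ / 2) (hd : ‖φ d - φ S.β‖ ≤ S.δ / 2)
    (hjump : ∀ t ∈ Set.Icc c d, S.Near t → S.W p t S.α - S.W p t S.β = k)
    {a b : ℝ} (hpa : p + S.β < a) (ha : a ∉ S.tube) (hb : b ∉ S.tube) (hac : a ≤ c) (hdb : d ≤ b) :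
    S.W p a S.α ≠ S.W p b S.α := by
  intro heq
  have hcd := hX.lt
  obtain ⟨e₁, e₂, h1, h2, ht, ha1, hb2, ε, hε, hhit, ⟨r, har, hr1, hr2, hrt⟩,
    r', hr'b, hr'1, hr'2, hr't⟩ :=
      S.exists_excursion ha hb (hX.sub ⟨le_rfl, hcd.le⟩) hac (by linarith)
  have hde : d < r' := by
    by_contra! h
    exact hr't (hX.sub ⟨by linarith, h⟩)
  have hpr : p + S.β < r := hpa.trans_le har
  have hx := hp.excursion hpr (by linarith) hrt hr't ht
    (fun x hx => hhit x (by linarith [hx.1]) (by linarith [hx.2]) _ S.α_mem)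
    (fun x hx => hhit x (by linarith [hx.1]) (by linarith [hx.2]) _ S.β_mem)
  have m1 := hp.mono hk hpa har ha hrt
  have m2 := hp.mono hk (b := b) (by linarith : p + S.β < r') hr'b hr't hb
  have hcI : c ∈ Set.Icc r r' := ⟨by linarith, by linarith⟩
  have hdI : d ∈ Set.Icc r r' := ⟨by linarith, by linarith⟩
  rcases hx with ⟨-, h⟩ | ⟨c', d', hX', hc', hd', hα, hβ, t, ht', hn, h⟩
  · exact h ⟨⟨c, hcI, hc⟩, d, hdI, hd⟩
  · rw [hjump t ⟨(hα c hcI hc).trans ht'.1, ht'.2.trans (hβ d hdI hd)⟩ hn] at h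
    have e : S.W p r' S.α / k = S.W p r S.α / k + 1 := by
      rw [← div_self hk0, ← add_div, ← h]; ring
    rw [e, Complex.add_re, Complex.one_re] at m2
    rw [heq] at m1
    linarith

end Frame

namespace Frame

variable {φ : ℝ → ℂ} {Λ : ℝ → ℝ → ℂ} {S : Frame φ Λ} {p p' : ℝ}

lemma Ret.not_mem_tube_of_close {a : ℝ}
    (h : ‖φ a - φ (S.β + 1)‖ ≤ S.δ / 2) : a ∉ S.tube := by
  intro ha
  have ha' : Metric.infDist (φ a) S.arc ≤ S.δ := ha
  have h1 : Metric.infDist (φ (S.β + 1)) S.arc ≤ Metric.infDist (φ a) S.arc +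
    dist (φ (S.β + 1)) (φ a) := Metric.infDist_le_infDist_add_dist
  rw [dist_comm, dist_eq_norm] at h1
  have h2 : 2 * S.δ < Metric.infDist (φ (S.β + 1)) S.arc := S.outside
  linarith [S.δ_pos]

/-- A later repetition of the arc that is close to it on the scale of an earlier one has the same
position with respect to that one. -/
lemma Ret.sweep_close (hp : S.Ret p) (hp' : S.Ret p') (hpp : p + S.β < p' + S.α)
    (hc : ∀ t ∈ Set.Icc (p + S.α) (p + S.β), ∀ u ∈ Set.Icc S.α S.β,
      ‖φ (p' + u) - φ u‖ ≤ 1 / 300 * ‖φ u - φ t‖) {t : ℝ}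
    (ht : t ∈ Set.Icc (p + S.α) (p + S.β)) :
    ‖(Λ (p' + S.β) t - Λ (p' + S.α) t) - (Λ S.β t - Λ S.α t)‖ ≤ 1 / 100 := by
  have t0 : 0 ≤ t := hp.strand.nonneg.trans ht.1
  have h1 : S.β < t := hp.lt.trans_le ht.1
  have h2 : t < p' + S.α := ht.2.trans_lt hpp
  have p0 := hp'.strand.nonneg
  obtain ⟨k₁, hk₁⟩ := S.log.exists_sign (a := p' + S.α) (b := p' + S.β) p0 t0 (Or.inl h2)
  obtain ⟨k₂, hk₂⟩ := S.log.exists_sign (a := S.α) (b := S.β) S.α_nonneg t0 (Or.inr h1)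
  have mem : ∀ u ∈ Set.Icc S.α S.β, p' + u ∈ Set.Icc (p' + S.α) (p' + S.β) :=
    fun u hu => ⟨by linarith [hu.1], by linarith [hu.2]⟩
  have := norm_increment_sub_le (F := fun u => Λ t (p' + u)) (G := Λ t)
    (f := fun u => φ (p' + u) - φ t) (g := fun u => φ u - φ t) S.α_lt_β.le
    ((S.log.cont_Icc p0 t0 (Or.inl h2)).comp (by fun_prop) mem)
    (S.log.cont_Icc S.α_nonneg t0 (Or.inr h1)) (fun u hu => hk₁ _ (mem u hu)) hk₂
    (fun u hu => by rw [sub_sub_sub_cancel_right]; exact hc t ht u hu)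
  rwa [S.log.symm t, S.log.symm t, S.log.symm t, S.log.symm t] at this

lemma Ret.first_of_first (hp : S.Ret p) (hp' : S.Ret p') (hpp : p + S.β < p' + S.α)
    (hc : ∀ t ∈ Set.Icc (p + S.α) (p + S.β), ∀ u ∈ Set.Icc S.α S.β,
      ‖φ (p' + u) - φ u‖ ≤ 1 / 300 * ‖φ u - φ t‖)
    (hf : S.First (p + S.α) (p + S.β) S.α S.β) :
    S.First (p + S.α) (p + S.β) (p' + S.α) (p' + S.β) := by
  refine (S.first_or_first hp.strand hp'.strand (Or.inl hpp)).resolve_right fun h => ?_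
  obtain ⟨t, ht, hn⟩ := S.exists_Near hp.strand
  have h1 := hp.sweep_close hp' hpp hc ht
  have := S.norm_gap_le (hf.1 t ht hn) (h.2 t ht hn)
  rw [norm_sub_rev] at this
  linarith

lemma Ret.first_of_second (hp : S.Ret p) (hp' : S.Ret p') (hpp : p + S.β < p' + S.α)
    (hc : ∀ t ∈ Set.Icc (p + S.α) (p + S.β), ∀ u ∈ Set.Icc S.α S.β,
      ‖φ (p' + u) - φ u‖ ≤ 1 / 300 * ‖φ u - φ t‖)
    (hf : S.First S.α S.β (p + S.α) (p + S.β)) :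
    S.First (p' + S.α) (p' + S.β) (p + S.α) (p + S.β) := by
  refine (S.first_or_first hp.strand hp'.strand (Or.inl hpp)).resolve_left fun h => ?_
  obtain ⟨t, ht, hn⟩ := S.exists_Near hp.strand
  have h1 := hp.sweep_close hp' hpp hc ht
  have := S.norm_gap_le (h.1 t ht hn) (hf.2 t ht hn)
  linarith

lemma Ret.W_eq_of_return (hp : S.Ret p) {a b : ℝ} (hpa : p + S.β < a) (hab : a ≤ b)
    (ha : a ∉ S.tube) (hb : b ∉ S.tube)
    (hc : ∀ r ∈ Set.Icc S.α (p + S.α), ‖φ b - φ a‖ ≤ 1 / 300 * ‖φ r - φ a‖) :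
    S.W p a S.α = S.W p b S.α := by
  have hpb := hpa.trans_le hab
  have a0 : 0 ≤ a := by linarith [hp.pos, S.β_nonneg]
  have b0 := a0.trans hab
  have hla : p + S.α < a := by linarith [S.α_lt_β]
  have hlb : p + S.α < b := by linarith [S.α_lt_β]
  obtain ⟨k₁, hk₁⟩ := S.log.exists_sign (a := S.α) (b := p + S.α) S.α_nonneg a0 (Or.inr hla)
  obtain ⟨k₂, hk₂⟩ := S.log.exists_sign (a := S.α) (b := p + S.α) S.α_nonneg b0 (Or.inr hlb)
  have h := norm_increment_sub_le (by linarith [hp.pos])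
    (S.log.cont_Icc S.α_nonneg b0 (Or.inr hlb)) (S.log.cont_Icc S.α_nonneg a0 (Or.inr hla)) hk₂ hk₁
    (fun r hr => by
      rw [sub_sub_sub_cancel_left, norm_sub_rev]; exact hc r hr)
  have lg : ∀ t, p + S.β < t → t ∉ S.tube →
      ‖Complex.log ((φ (p + S.α) - φ t) / (φ S.α - φ t))‖ ≤ 1 / 200 := fun t ht htt => by
    obtain ⟨h1, h2, h3, h4⟩ := hp.lt_of_mem S.α_mem ht
    refine norm_log_div_le (S.ne_of_lt h1 h3) ?_
    rw [sub_sub_sub_cancel_right, norm_sub_rev (φ S.α)]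
    linarith [hp.close _ S.α_mem, dist_of_not_mem_tube htt S.α_mem, S.δ_pos]
  have l1 := lg a hpa ha
  have l2 := lg b hpb hb
  rw [eq_comm, ← sub_eq_zero]
  refine eq_zero_of_exp_eq_one ?_ ?_
  · rw [Complex.exp_sub, hp.exp_W S.α_mem hpa, hp.exp_W S.α_mem hpb, div_one]
  · have e : S.W p b S.α - S.W p a S.α =
      ((Λ b (p + S.α) - Λ b S.α) - (Λ a (p + S.α) - Λ a S.α))
      - (Complex.log ((φ (p + S.α) - φ b) / (φ S.α - φ b))
        - Complex.log ((φ (p + S.α) - φ a) / (φ S.α - φ a))) := by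
      rw [W, W, S.log.symm b, S.log.symm b, S.log.symm a, S.log.symm a]; ring
    rw [e]
    refine (norm_sub_le _ _).trans ?_
    have := norm_sub_le (Complex.log ((φ (p + S.α) - φ b) / (φ S.α - φ b)))
      (Complex.log ((φ (p + S.α) - φ a) / (φ S.α - φ a)))
    linarith

/-- A uniform lower bound for the distance of two disjoint pieces of an injective path. -/
lemma exists_pos_le_norm (S : Frame φ Λ) {a b c d : ℝ} (ha : 0 ≤ a) (hbc : b < c) :
    ∃ ε > 0, ∀ u ∈ Set.Icc a b, ∀ t ∈ Set.Icc c d, ε ≤ 1 / 300 * ‖φ u - φ t‖ := by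
  have hφ := S.cont
  rcases (Set.Icc a b ×ˢ Set.Icc c d).eq_empty_or_nonempty with h | h
  · exact ⟨1, one_pos, fun u hu t ht => absurd (Set.mk_mem_prod hu ht) (by rw [h]; simp)⟩
  · obtain ⟨x, hx, hmin⟩ := (isCompact_Icc.prod isCompact_Icc).exists_isMinOn h
      (f := fun x : ℝ × ℝ => 1 / 300 * ‖φ x.1 - φ x.2‖) (by fun_prop)
    refine ⟨1 / 300 * ‖φ x.1 - φ x.2‖, ?_, fun u hu t ht => hmin (Set.mk_mem_prod hu ht)⟩
    have := S.ne_of_lt (ha.trans hx.1.1) (hx.1.2.trans_lt (hbc.trans_le hx.2.1))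
    have := norm_pos_iff.2 this
    positivity

/-- Two repetitions of the arc lying on the same side of it contradict recurrence. -/
lemma Ret.not_same_side (hp : S.Ret p) (hp' : S.Ret p') (hpp : p + S.β + 1 ≤ p' + S.α)
    (hrec : ∀ T : ℝ, ∀ ε > 0, ∃ t ≥ T, ∀ u ∈ Set.Icc 0 T, ‖φ (t + u) - φ u‖ ≤ ε)
    (hc1 : ‖φ (p + (S.β + 1)) - φ (S.β + 1)‖ ≤ S.δ / 1000)
    (hc : ∀ t ∈ Set.Icc (p + S.α) (p + S.β), ∀ u ∈ Set.Icc S.α S.β,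
      ‖φ (p' + u) - φ u‖ ≤ 1 / 300 * ‖φ u - φ t‖)
    (h : (S.First (p + S.α) (p + S.β) S.α S.β ∧ S.First (p' + S.α) (p' + S.β) S.α S.β) ∨
      (S.First S.α S.β (p + S.α) (p + S.β) ∧ S.First S.α S.β (p' + S.α) (p' + S.β))) : False := by
  have hδ := S.δ_pos
  have hβ := S.β_nonneg
  have hp0 := hp.pos
  set a := p + (S.β + 1) with ha
  obtain ⟨ε, hε, hεa⟩ := S.exists_pos_le_norm (a := S.α) (b := p + S.α) (c := a) (d := a)
    S.α_nonneg (by linarith [S.α_lt_β])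
  obtain ⟨R, hR, hRc⟩ := hrec (max a (p' + S.β)) (min ε (S.δ / 1000)) (by positivity)
  have hra := hRc a ⟨by linarith, le_max_left _ _⟩
  have hR1 : a ≤ R := (le_max_left _ _).trans hR
  have hR2 : p' + S.β ≤ R := (le_max_right _ _).trans hR
  have hat : a ∉ S.tube := Ret.not_mem_tube_of_close (by linarith)
  have hbt : R + a ∉ S.tube := by
    refine Ret.not_mem_tube_of_close ?_
    have := norm_sub_le_norm_sub_add_norm_sub (φ (R + a)) (φ a) (φ (S.β + 1))
    linarith [hra.trans (min_le_right _ _)]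
  have hW : S.W p a S.α = S.W p (R + a) S.α :=
    hp.W_eq_of_return (by linarith) (by linarith) hat hbt
      (fun r hr => (hra.trans (min_le_left _ _)).trans (hεa r hr a ⟨le_rfl, le_rfl⟩))
  have hl : ‖φ (p' + S.α) - φ S.α‖ ≤ S.δ / 2 := (hp'.close _ S.α_mem).trans (by linarith)
  have hr : ‖φ (p' + S.β) - φ S.β‖ ≤ S.δ / 2 := (hp'.close _ S.β_mem).trans (by linarith)
  have hpp' : p + S.β < p' + S.α := by linarith
  rcases h with ⟨h1, h2⟩ | ⟨h1, h2⟩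
  · have h3 := hp.first_of_first hp' hpp' hc h1
    refine hp.W_ne_of_jump S.κ_ne_zero
      (fun c d hX hcd t ht hn => hp.jump_cases_of_first h1 hX hcd ht hn) hp'.strand hl hr
      (fun t ht hn => hp.jump_eq (hpp'.trans_le ht.1) hn (h2.1 t ht hn) (h3.2 t ht hn)
        (by ring) S.exp_κ) (by linarith) hat hbt (by linarith) (by linarith) hW
  · have h3 := hp.first_of_second hp' hpp' hc h1
    refine hp.W_ne_of_jump (neg_ne_zero.2 S.κ_ne_zero)
      (fun c d hX hcd t ht hn => hp.jump_cases_of_second h1 hX hcd ht hn) hp'.strand hl hr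
      (fun t ht hn => hp.jump_eq (hpp'.trans_le ht.1) hn (h2.2 t ht hn) (h3.1 t ht hn)
        (by ring) exp_neg_κ) (by linarith) hat hbt (by linarith) (by linarith) hW

/-- A recurrent path has no frame. -/
theorem not_recurrent (S : Frame φ Λ)
    (hrec : ∀ T : ℝ, ∀ ε > 0, ∃ t ≥ T, ∀ u ∈ Set.Icc 0 T, ‖φ (t + u) - φ u‖ ≤ ε) : False := by
  have hδ := S.δ_pos
  have hα := S.α_nonneg
  have hβ := S.β_nonneg
  have hαβ := S.α_lt_β
  have next : ∀ T : ℝ, ∀ ε > 0, ∃ p, T ≤ p ∧ S.Ret p ∧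
      ‖φ (p + (S.β + 1)) - φ (S.β + 1)‖ ≤ S.δ / 1000 ∧
      ∀ u ∈ Set.Icc S.α S.β, ‖φ (p + u) - φ u‖ ≤ ε := by
    intro T ε hε
    obtain ⟨p, hp, h⟩ := hrec (max T (S.β + 1)) (min ε (S.δ / 1000)) (by positivity)
    have h1 : S.β + 1 ≤ p := (le_max_right _ _).trans hp
    have mem : ∀ u ∈ Set.Icc S.α S.β, u ∈ Set.Icc 0 (max T (S.β + 1)) := fun u hu =>
      ⟨hα.trans hu.1, (hu.2.trans (by linarith)).trans (le_max_right T (S.β + 1))⟩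
    exact ⟨p, (le_max_left _ _).trans hp,
      ⟨by linarith, fun u hu => (h u (mem u hu)).trans (min_le_right _ _)⟩,
      (h _ ⟨by linarith, le_max_right _ _⟩).trans (min_le_right _ _),
      fun u hu => (h u (mem u hu)).trans (min_le_left _ _)⟩
  have sep : ∀ p, S.Ret p → ∃ ε > 0, ∀ t ∈ Set.Icc (p + S.α) (p + S.β),
      ∀ u ∈ Set.Icc S.α S.β, ε ≤ 1 / 300 * ‖φ u - φ t‖ := fun p hp => by
    obtain ⟨ε, hε, h⟩ := S.exists_pos_le_norm (a := S.α) (b := S.β) (c := p + S.α)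
      (d := p + S.β) hα hp.lt
    exact ⟨ε, hε, fun t ht u hu => h u hu t ht⟩
  obtain ⟨p₁, -, hp₁, hc₁, -⟩ := next 0 1 one_pos
  obtain ⟨ε₁, hε₁, h₁⟩ := sep p₁ hp₁
  obtain ⟨p₂, h₁₂, hp₂, hc₂, hcl₂⟩ := next (p₁ + S.β + 1) ε₁ hε₁
  obtain ⟨ε₂, hε₂, h₂⟩ := sep p₂ hp₂
  obtain ⟨p₃, h₂₃, hp₃, hc₃, hcl₃⟩ := next (p₂ + S.β + 1) (min ε₁ ε₂) (lt_min hε₁ hε₂)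
  have n₁₂ := hp₁.not_same_side hp₂ (by linarith) hrec hc₁
    (fun t ht u hu => (hcl₂ u hu).trans (h₁ t ht u hu))
  have n₁₃ := hp₁.not_same_side hp₃ (by linarith) hrec hc₁
    (fun t ht u hu => ((hcl₃ u hu).trans (min_le_left _ _)).trans (h₁ t ht u hu))
  have n₂₃ := hp₂.not_same_side hp₃ (by linarith) hrec hc₂
    (fun t ht u hu => ((hcl₃ u hu).trans (min_le_right _ _)).trans (h₂ t ht u hu))
  have o₁ := S.first_or_first hp₁.strand S.strand_self (Or.inr hp₁.lt)
  have o₂ := S.first_or_first hp₂.strand S.strand_self (Or.inr hp₂.lt)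
  have o₃ := S.first_or_first hp₃.strand S.strand_self (Or.inr hp₃.lt)
  tauto

end Frame

theorem exists_eq_add_pi {f : ℝ → ℝ} (hf : Continuous f) (hp : ∀ θ, f (θ + 2 * Real.pi) = f θ) :
    ∃ θ, f (θ + Real.pi) = f θ := by
  have hg : Continuous fun θ => f (θ + Real.pi) - f θ := by fun_prop
  have h2 : f (Real.pi + Real.pi) = f 0 := by rw [← hp 0]; congr 1; ring
  obtain ⟨θ, hθ⟩ : (0 : ℝ) ∈ Set.range fun θ => f (θ + Real.pi) - f θ := by
    refine mem_range_of_exists_le_of_exists_ge hg ?_ ?_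
    · rcases le_total (f (0 + Real.pi)) (f 0) with h | h
      · exact ⟨0, by linarith⟩
      · exact ⟨Real.pi, by rw [h2]; rw [zero_add] at h; linarith⟩
    · rcases le_total (f (0 + Real.pi)) (f 0) with h | h
      · exact ⟨Real.pi, by rw [h2]; rw [zero_add] at h; linarith⟩
      · exact ⟨0, by linarith⟩
  exact ⟨θ, sub_eq_zero.1 hθ⟩

/-- An injective arc in the plane has a continuous parameter function. -/
theorem exists_parameter {φ : ℝ → ℂ} {a b : ℝ} (hab : a ≤ b) (hφ : ContinuousOn φ (Set.Icc a b))
    (hi : Set.InjOn φ (Set.Icc a b)) :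
    ∃ π : ℂ → ℝ, Continuous π ∧ (∀ x, π x ∈ Set.Icc a b) ∧ ∀ u ∈ Set.Icc a b, π (φ u) = u := by
  have he : IsClosedEmbedding (Set.domRestrict (Set.Icc a b) φ) :=
    (continuousOn_iff_continuous_domRestrict.1 hφ).isClosedEmbedding hi.injective
  obtain ⟨g, hg⟩ := ContinuousMap.exists_extension (Y := ℝ) he ⟨Subtype.val, continuous_subtype_val⟩
  refine ⟨fun x => Set.projIcc a b hab (g x), by fun_prop, fun x => Subtype.coe_prop _,
    fun u hu => ?_⟩
  have : g (φ u) = u := DFunLike.congr_fun hg ⟨u, hu⟩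
  simp only [this, Set.projIcc_of_mem hab hu]

/-- An injective arc in the plane has empty interior. -/
theorem interior_arc_eq_empty {φ : ℝ → ℂ} {a b : ℝ} (hφ : ContinuousOn φ (Set.Icc a b))
    (hi : Set.InjOn φ (Set.Icc a b)) : interior (φ '' Set.Icc a b) = ∅ := by
  rcases lt_or_ge b a with hab | hab
  · simp [Set.Icc_eq_empty (not_le.2 hab)]
  obtain ⟨π, hπ, -, hπφ⟩ := exists_parameter hab hφ hi
  by_contra hne
  obtain ⟨z, hz⟩ := Set.nonempty_iff_ne_empty.2 hne
  obtain ⟨ε, hε, hball⟩ := Metric.isOpen_iff.1 isOpen_interior z hz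
  let γ : ℝ → ℂ := fun θ => circleMap z (ε / 2) θ
  have hγ : ∀ θ, γ θ ∈ φ '' Set.Icc a b := fun θ => interior_subset (hball (by
    have := circleMap_mem_sphere z (half_pos hε).le θ
    rw [mem_sphere_iff_norm] at this
    rw [mem_ball_iff_norm]
    linarith))
  obtain ⟨θ, hθ⟩ := exists_eq_add_pi (f := fun θ => π (γ θ))
    (hπ.comp (continuous_circleMap z _)) (fun θ => by simp only [γ]; rw [periodic_circleMap])
  obtain ⟨u, hu, hue⟩ := hγ θ
  obtain ⟨v, hv, hve⟩ := hγ (θ + Real.pi)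
  rw [← hue, ← hve, hπφ u hu, hπφ v hv] at hθ
  rw [hθ, hue] at hve
  simp only [γ, circleMap, add_right_inj, Complex.ofReal_add, add_mul, Complex.exp_add,
    Complex.exp_pi_mul_I, mul_neg, mul_one] at hve
  have : ((ε / 2 : ℝ) : ℂ) * Complex.exp (θ * Complex.I) ≠ 0 :=
    mul_ne_zero (by exact_mod_cast (half_pos hε).ne') (Complex.exp_ne_zero _)
  exact this (self_eq_neg.1 hve)

theorem eventually_small {E : Type*} [NormedAddCommGroup E] {x : E} {P : E → Prop}
    (h : ∀ᶠ y in 𝓝 x, P y) : ∀ᶠ η in 𝓝[>] (0 : ℝ), ∀ y, ‖y - x‖ ≤ 4 * η → P y := by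
  obtain ⟨ε, hε, hP⟩ := Metric.eventually_nhds_iff.1 h
  have : Set.Ioo (0:ℝ) (ε / 4) ∈ 𝓝[>] (0:ℝ) := Ioo_mem_nhdsGT (by positivity)
  filter_upwards [this] with η hη y hy
  exact hP (by rw [dist_eq_norm]; linarith [hη.2])

theorem eventually_mul_le {c k : ℝ} (hc : 0 < c) : ∀ᶠ η in 𝓝[>] (0 : ℝ), k * η ≤ c := by
  refine nhdsWithin_le_nhds ?_
  have : Tendsto (fun η : ℝ => k * η) (𝓝 0) (𝓝 (k * 0)) := by
    exact (continuous_const.mul continuous_id).tendsto 0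
  rw [mul_zero] at this
  exact (this.eventually (gt_mem_nhds hc)).mono fun _ h => le_of_lt h

theorem exists_pos_le_norm_of_ne_zero {f : ℝ → ℂ} {a b : ℝ} (hf : ContinuousOn f (Set.Icc a b))
    (h0 : ∀ x ∈ Set.Icc a b, f x ≠ 0) : ∃ c > 0, ∀ x ∈ Set.Icc a b, c ≤ ‖f x‖ := by
  rcases (Set.Icc a b).eq_empty_or_nonempty with h | h
  · exact ⟨1, one_pos, fun x hx => by rw [h] at hx; exact hx.elim⟩
  · obtain ⟨x, hx, hm⟩ := isCompact_Icc.exists_isMinOn h hf.norm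
    exact ⟨‖f x‖, norm_pos_iff.2 (h0 x hx), fun y hy => hm hy⟩

theorem exists_continuous_log_Icc {f : ℝ → ℂ} {a b : ℝ} (hab : a ≤ b) (hf : Continuous f)
    (h0 : ∀ x ∈ Set.Icc a b, f x ≠ 0) :
    ∃ l : ℝ → ℂ, Continuous l ∧ ∀ x ∈ Set.Icc a b, Complex.exp (l x) = f x := by
  obtain ⟨l, hl, h⟩ := exists_continuous_log (g := fun x => f (max a (min x b))) (by fun_prop)
    (fun x => h0 _ ⟨le_max_left _ _, max_le hab (min_le_right _ _)⟩)
  exact ⟨l, hl, fun x hx => by rw [h, min_eq_left hx.2, max_eq_right hx.1]⟩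

theorem exists_tube {φ : ℝ → ℂ} {a b η : ℝ} (hφ : Continuous φ) (hab : a ≤ b) {π : ℂ → ℝ}
    (hπ : Continuous π) (hπφ : ∀ u ∈ Set.Icc a b, π (φ u) = u) (hη : 0 < η) :
    ∃ δ > 0, ∀ x, Metric.infDist x (φ '' Set.Icc a b) ≤ δ → ‖x - φ (π x)‖ ≤ η := by
  have hA : IsCompact (φ '' Set.Icc a b) := isCompact_Icc.image hφ
  have hop : IsOpen {x : ℂ | ‖x - φ (π x)‖ < η} :=
    isOpen_lt (by fun_prop) continuous_const
  obtain ⟨δ, hδ, hsub⟩ := hA.exists_cthickening_subset_open hop (by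
    rintro _ ⟨u, hu, rfl⟩
    simpa [hπφ u hu] using hη)
  refine ⟨δ, hδ, fun x hx => ?_⟩
  obtain ⟨y, hy, he⟩ := hA.exists_infDist_eq_dist ⟨_, a, ⟨le_rfl, hab⟩, rfl⟩ x
  exact (hsub (Metric.mem_cthickening_of_dist_le x y δ _ hy (he ▸ hx))).le

/-- Around every arc of an injective planar path without reverse passages there is a frame. -/
theorem exists_frame {φ : ℝ → ℂ} {Λ : ℝ → ℝ → ℂ} (hφ : Continuous φ)
    (hi : Set.InjOn φ (Set.Ici 0)) (hΛ : IsChordLog φ Λ) {α β : ℝ} (hα : 0 ≤ α) (hαβ : α < β)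
    (hno : ∀ u v, α ≤ u → u < v → v ≤ β → ∃ δ > 0, ∀ t₁ t₂, 0 ≤ t₁ → t₁ < t₂ →
      ‖φ t₁ - φ v‖ ≤ δ → ‖φ t₂ - φ u‖ ≤ δ →
      ¬ ∀ t ∈ Set.Icc t₁ t₂, Metric.infDist (φ t) (φ '' Set.Icc α β) ≤ δ) :
    Nonempty (Frame φ Λ) := by
  have hβ : 0 ≤ β := hα.trans hαβ.le
  have hsub : Set.Icc α β ⊆ Set.Ici 0 := fun x hx => hα.trans hx.1
  have hA : IsCompact (φ '' Set.Icc α β) := isCompact_Icc.image hφ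
  have hAne : (φ '' Set.Icc α β).Nonempty := ⟨_, α, ⟨le_rfl, hαβ.le⟩, rfl⟩
  have ne : ∀ s t, 0 ≤ s → 0 ≤ t → s ≠ t → 0 < ‖φ s - φ t‖ := fun s t hs ht hst =>
    norm_pos_iff.2 (sub_ne_zero.2 fun h => hst (hi hs ht h))
  obtain ⟨π, hπ, hπm, hπφ⟩ := exists_parameter hαβ.le hφ.continuousOn (hi.mono hsub)
  set m := (α + β) / 2 with hm
  have hm1 : α < m := by rw [hm]; linarith
  have hm2 : m < β := by rw [hm]; linarith
  have d1 := ne m α (by linarith) hα hm1.ne'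
  have d2 := ne m β (by linarith) hβ hm2.ne
  obtain ⟨q, hq, hqA⟩ : ∃ q ∈ Metric.ball (φ m) (min ‖φ m - φ α‖ ‖φ m - φ β‖ / 2),
      q ∉ φ '' Set.Icc α β := by
    by_contra! h
    have : φ m ∈ interior (φ '' Set.Icc α β) :=
      interior_mono h (by
        rw [Metric.isOpen_ball.interior_eq]
        exact Metric.mem_ball_self (by positivity))
    rw [interior_arc_eq_empty hφ.continuousOn (hi.mono hsub)] at this
    exact this
  rw [Metric.mem_ball, dist_eq_norm] at hq
  obtain ⟨_, ⟨u₀, hu₀, rfl⟩, hx⟩ := hA.exists_infDist_eq_dist hAne q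
  have hnear : ∀ u ∈ Set.Icc α β, ‖φ u₀ - q‖ ≤ ‖φ u - q‖ := fun u hu => by
    have := Metric.infDist_le_dist_of_mem (x := q) (Set.mem_image_of_mem φ hu)
    rw [hx, dist_eq_norm, dist_eq_norm, norm_sub_rev, norm_sub_rev q] at this
    exact this
  have hm0 := hnear m ⟨hm1.le, hm2.le⟩
  have hu₀m : ‖φ m - φ u₀‖ < min ‖φ m - φ α‖ ‖φ m - φ β‖ := by
    have := norm_sub_le_norm_sub_add_norm_sub (φ m) q (φ u₀)
    rw [norm_sub_rev (φ m) q, norm_sub_rev q (φ u₀)] at this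
    rw [norm_sub_rev (φ m) q] at hm0
    linarith
  have hα0 : α < u₀ := lt_of_le_of_ne hu₀.1 (by
    rintro rfl; exact absurd (min_le_left ‖φ m - φ α‖ ‖φ m - φ β‖) (not_le.2 hu₀m))
  have h0β : u₀ < β := lt_of_le_of_ne hu₀.2 (by
    rintro rfl; exact absurd (min_le_right ‖φ m - φ α‖ ‖φ m - φ u₀‖) (not_le.2 hu₀m))
  have hu0 : 0 ≤ u₀ := hα.trans hα0.le
  have hqne : ∀ u ∈ Set.Icc α β, φ u - q ≠ 0 := fun u hu h =>
    hqA ⟨u, hu, sub_eq_zero.1 h⟩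
  have hseg : ∀ γ ∈ Set.Icc α β, γ ≠ u₀ → ∀ ρ ∈ Set.Icc (0:ℝ) 1,
      φ γ - (q + ρ * (φ u₀ - q)) ≠ 0 := by
    intro γ hγ hne ρ hρ h
    have e : φ γ - q = ρ * (φ u₀ - q) := by linear_combination h
    have h1 := hnear γ hγ
    have h2 : 0 < ‖φ u₀ - q‖ := norm_pos_iff.2 (hqne u₀ hu₀)
    rw [e, norm_mul, Complex.norm_real, Real.norm_of_nonneg hρ.1] at h1
    have h3 : ρ = 1 := le_antisymm hρ.2 (by nlinarith)
    rw [h3, Complex.ofReal_one, one_mul, sub_left_inj] at e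
    exact hne (hi (hsub hγ) (hsub hu₀) e)
  have hαm : α ∈ Set.Icc α β := ⟨le_rfl, hαβ.le⟩
  have hβm : β ∈ Set.Icc α β := ⟨hαβ.le, le_rfl⟩
  obtain ⟨lam, hlam, hlame⟩ := exists_continuous_log_Icc (f := fun u => φ u - q) hαβ.le
    (by fun_prop) hqne
  obtain ⟨μα, hμα, hμαe⟩ := exists_continuous_log_Icc (f := fun ρ => φ α - (q + ρ * (φ u₀ - q)))
    zero_le_one (by fun_prop) (hseg α hαm hα0.ne)
  obtain ⟨μβ, hμβ, hμβe⟩ := exists_continuous_log_Icc (f := fun ρ => φ β - (q + ρ * (φ u₀ - q)))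
    zero_le_one (by fun_prop) (hseg β hβm h0β.ne')
  obtain ⟨cq, hcq, hcq'⟩ := exists_pos_le_norm_of_ne_zero (f := fun u => φ u - q)
    (by fun_prop) hqne
  obtain ⟨cα, hcα, hcα'⟩ := exists_pos_le_norm_of_ne_zero
    (f := fun ρ => φ α - (q + ρ * (φ u₀ - q))) (by fun_prop) (hseg α hαm hα0.ne)
  obtain ⟨cβ, hcβ, hcβ'⟩ := exists_pos_le_norm_of_ne_zero
    (f := fun ρ => φ β - (q + ρ * (φ u₀ - q))) (by fun_prop) (hseg β hβm h0β.ne')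
  obtain ⟨r₁, hr₁, no₁⟩ := hno α u₀ le_rfl hα0 h0β.le
  obtain ⟨r₂, hr₂, no₂⟩ := hno u₀ β hα0.le h0β le_rfl
  obtain ⟨r₃, hr₃, no₃⟩ := hno α β le_rfl hαβ le_rfl
  have f1 := ne u₀ α hu0 hα hα0.ne'
  have f2 := ne u₀ β hu0 hβ h0β.ne
  have f3 := ne α β hα hβ hαβ.ne
  obtain ⟨r, hr, hrr⟩ : ∃ r > 0, r ≤ r₁ ∧ r ≤ r₂ ∧ r ≤ r₃ ∧ 2 * r < ‖φ u₀ - φ α‖ ∧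
      2 * r < ‖φ u₀ - φ β‖ ∧ 2 * r < ‖φ α - φ β‖ := by
    have c : ∀ x > (0:ℝ), ∀ᶠ r in 𝓝[>] (0:ℝ), 1 * r ≤ x := fun x hx => eventually_mul_le hx
    obtain ⟨r, h1, h2, h3, h4, h5, h6, h7⟩ := ((c r₁ hr₁).and <| (c r₂ hr₂).and <|
      (c r₃ hr₃).and <| (c _ (div_pos f1 three_pos)).and <| (c _ (div_pos f2 three_pos)).and <|
      (c _ (div_pos f3 three_pos)).and self_mem_nhdsWithin).exists
    have : 0 < r := h7
    exact ⟨r, this, by linarith, by linarith, by linarith, by linarith, by linarith, by linarith⟩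
  have hΛc : ∀ γ x, 0 ≤ γ → π x ≠ γ → ∀ᶠ y in 𝓝 x, ‖Λ γ (π y) - Λ γ (π x)‖ ≤ 1 / 100 := by
    intro γ x hγ hne
    have hop : IsOpen {y | π y ≠ γ} := isOpen_ne_fun hπ continuous_const
    have hc : ContinuousOn (fun y => Λ γ (π y)) {y | π y ≠ γ} :=
      (hΛ.cont γ hγ).comp hπ.continuousOn fun y hy => ⟨hα.trans (hπm y).1, hy⟩
    have := (hc.continuousAt (hop.mem_nhds hne)).eventually
      (Metric.closedBall_mem_nhds (Λ γ (π x)) (by norm_num : (0:ℝ) < 1 / 100))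
    exact this.mono fun y hy => by rwa [← dist_eq_norm]
  have hlc : ∀ x, ∀ᶠ y in 𝓝 x, ‖lam (π y) - lam (π x)‖ ≤ 1 / 100 := by
    intro x
    have := ((hlam.comp hπ).continuousAt (x := x)).eventually
      (Metric.closedBall_mem_nhds (lam (π x)) (by norm_num : (0:ℝ) < 1 / 100))
    exact this.mono fun y hy => by rwa [← dist_eq_norm]
  have pα := hπφ α hαm
  have pβ := hπφ β hβm
  have p0 := hπφ u₀ hu₀
  have c1 := eventually_small (hΛc α (φ u₀) hα (by rw [p0]; exact hα0.ne'))
  have c2 := eventually_small (hΛc α (φ β) hα (by rw [pβ]; exact hαβ.ne'))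
  have c3 := eventually_small (hΛc β (φ u₀) hβ (by rw [p0]; exact h0β.ne))
  have c4 := eventually_small (hΛc β (φ α) hβ (by rw [pα]; exact hαβ.ne))
  have c5 := eventually_small ((hπ.continuousAt (x := φ α)).eventually_lt_const
    (show π (φ α) < u₀ by rwa [pα]))
  have c6 := eventually_small ((hπ.continuousAt (x := φ β)).eventually_const_lt
    (show u₀ < π (φ β) by rwa [pβ]))
  have c7 := eventually_small (hlc (φ α))
  have c8 := eventually_small (hlc (φ β))
  have c0 : ∀ᶠ η in 𝓝[>] (0:ℝ), 0 < η := self_mem_nhdsWithin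
  obtain ⟨η, hη, h1, h2, h3, h4, h5, h6, h7, h8, h9, h10, h11, h12⟩ :=
    (c0.and <| c1.and <| c2.and <| c3.and <|
      c4.and <| c5.and <| c6.and <| c7.and <| c8.and <|
      (eventually_mul_le (k := 1000) hr).and <| (eventually_mul_le (k := 300) hcq).and <|
      (eventually_mul_le (k := 1500) hcα).and (eventually_mul_le (k := 1500) hcβ)).exists
  rw [p0] at h1 h3
  rw [pβ] at h2 h8
  rw [pα] at h4 h7
  have hη0 : 0 < η := hη
  obtain ⟨δ₀, hδ₀, htr⟩ := exists_tube hφ hαβ.le hπ hπφ hη0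
  have hout : 0 < Metric.infDist (φ (β + 1)) (φ '' Set.Icc α β) := by
    refine (hA.isClosed.notMem_iff_infDist_pos hAne).1 ?_
    rintro ⟨u, hu, he⟩
    have := hi (hsub hu) (Set.mem_Ici.2 (by linarith)) he
    linarith [hu.2]
  obtain ⟨δ, hδ, hδ1, hδ2, hδ3⟩ : ∃ δ > 0, δ ≤ δ₀ ∧ δ ≤ η ∧
      2 * δ < Metric.infDist (φ (β + 1)) (φ '' Set.Icc α β) := by
    refine ⟨min (min δ₀ η) (Metric.infDist (φ (β + 1)) (φ '' Set.Icc α β) / 3), by positivity,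
      (min_le_left _ _).trans (min_le_left _ _), (min_le_left _ _).trans (min_le_right _ _), ?_⟩
    linarith [min_le_right (min δ₀ η) (Metric.infDist (φ (β + 1)) (φ '' Set.Icc α β) / 3)]
  have hδr : δ ≤ r := by linarith
  refine ⟨{ α := α, β := β, u₀ := u₀, δ := δ, η := η, r := r, q := q, π := π, lam := lam, μα := μα,
            μβ := μβ, cont := hφ, inj := hi, log := hΛ, α_nonneg := hα, α_lt := hα0, lt_β := h0β,
            π_mem := hπm, π_cont := hπ, δ_pos := hδ, δ_le := hδ2, η_le := h9,
            track := fun x hx => htr x (hx.trans hδ1), noreverse := ?_, farα := hrr.2.2.2.1,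
            farβ := hrr.2.2.2.2.1, farαβ := hrr.2.2.2.2.2, closeα₀ := h1, closeαβ := h2,
            closeβ₀ := h3, closeβα := h4, closeα := fun x hx => ⟨h5 x hx, h7 x hx⟩,
            closeβ := fun x hx => ⟨h6 x hx, h8 x hx⟩, lam_cont := hlam, lam_exp := hlame,
            farq := fun u hu => h10.trans (hcq' u hu), μα_cont := hμα, μβ_cont := hμβ,
            μα_exp := hμαe, μβ_exp := hμβe, farμα := fun u hu => h11.trans (hcα' u hu),
            farμβ := fun u hu => h12.trans (hcβ' u hu), outside := hδ3, nearest := hnear }⟩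
  intro u v hu hv huv t₁ t₂ ht₁ ht hv1 hu1 htube
  simp only [Set.mem_insert_iff, Set.mem_singleton_iff] at hu hv
  rcases hu with rfl | rfl <;> rcases hv with rfl | rfl
  · exact no₁ t₁ t₂ ht₁ ht (hv1.trans hrr.1) (hu1.trans hrr.1)
      fun t h => (htube t h).trans (hδr.trans hrr.1)
  · exact no₃ t₁ t₂ ht₁ ht (hv1.trans hrr.2.2.1) (hu1.trans hrr.2.2.1)
      fun t h => (htube t h).trans (hδr.trans hrr.2.2.1)
  · exact huv.false
  · exact no₂ t₁ t₂ ht₁ ht (hv1.trans hrr.2.1) (hu1.trans hrr.2.1)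
      fun t h => (htube t h).trans (hδr.trans hrr.2.1)

/-- Every arc of a recurrent injective planar path is approximately traversed backwards. -/
theorem exists_reverse {φ : ℝ → ℂ} (hφ : Continuous φ) (hi : Set.InjOn φ (Set.Ici 0))
    (hrec : ∀ T : ℝ, ∀ ε > 0, ∃ t ≥ T, ∀ u ∈ Set.Icc 0 T, ‖φ (t + u) - φ u‖ ≤ ε)
    {α β : ℝ} (hα : 0 ≤ α) (hαβ : α < β) :
    ∃ u v, α ≤ u ∧ u < v ∧ v ≤ β ∧ ∀ δ > 0, ∃ t₁ t₂, 0 ≤ t₁ ∧ t₁ < t₂ ∧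
      ‖φ t₁ - φ v‖ ≤ δ ∧ ‖φ t₂ - φ u‖ ≤ δ ∧
      ∀ t ∈ Set.Icc t₁ t₂, Metric.infDist (φ t) (φ '' Set.Icc α β) ≤ δ := by
  by_contra hcon
  obtain ⟨Λ, hΛ⟩ := exists_isChordLog hφ hi
  obtain ⟨S⟩ := exists_frame hφ hi hΛ hα hαβ (by
    intro u v hu huv hv
    by_contra h
    push Not at h
    exact hcon ⟨u, v, hu, huv, hv, fun δ hδ => h δ hδ⟩)
  exact S.not_recurrent hrec

/-- `φ` is a cluster point of its own shifts at infinity. -/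
def ShiftRecurs {Y : Type*} [TopologicalSpace Y] (φ : C(ℝ≥0, Y)) : Prop :=
  MapClusterPt φ atTop fun t => bebShift t φ

theorem IsShiftRecurrent.shiftRecurs {Y : Type*} [TopologicalSpace Y] {φ : C(ℝ≥0, Y)}
    (h : IsShiftRecurrent φ) : ShiftRecurs φ := by
  obtain ⟨t, ht, h⟩ := h
  exact MapClusterPt.of_comp (φ := t) (p := atTop) ht h.mapClusterPt

theorem ShiftRecurs.comp {Y Y' : Type*} [TopologicalSpace Y] [TopologicalSpace Y'] {φ : C(ℝ≥0, Y)}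
    (h : ShiftRecurs φ) (g : C(Y, Y')) : ShiftRecurs (g.comp φ) :=
  h.continuousAt_comp (ContinuousMap.continuous_postcomp g).continuousAt

theorem shiftRecurs_iff {Y : Type*} [PseudoMetricSpace Y] {φ : C(ℝ≥0, Y)} :
    ShiftRecurs φ ↔
      ∀ T : ℝ≥0, ∀ ε > 0, ∃ t ≥ T, ∀ u ≤ T, dist (φ (u + t)) (φ u) ≤ ε := by
  constructor
  · intro h T ε hε
    have h1 := ContinuousMap.tendsto_iff_forall_isCompact_tendstoUniformlyOn.1
      (tendsto_id (x := 𝓝 φ)) (Set.Icc 0 T) isCompact_Icc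
    obtain ⟨t, h, ht⟩ := ((h.frequently (Metric.tendstoUniformlyOn_iff.1 h1 ε hε)).and_eventually
      (eventually_ge_atTop T)).exists
    exact ⟨t, ht, fun u hu => by
      rw [dist_comm]
      exact (h u ⟨zero_le, hu⟩).le⟩
  · intro h
    choose t ht hd using fun n : ℕ => h n (1 / ((n : ℝ) + 1)) (by positivity)
    have ht' : Tendsto t atTop atTop := tendsto_atTop_mono ht tendsto_natCast_atTop_atTop
    refine MapClusterPt.of_comp (φ := t) (p := atTop) ht' (Tendsto.mapClusterPt ?_)
    rw [ContinuousMap.tendsto_iff_forall_isCompact_tendstoUniformlyOn]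
    intro K hK
    rw [Metric.tendstoUniformlyOn_iff]
    intro ε hε
    obtain ⟨b, hb⟩ := hK.bddAbove
    filter_upwards [tendsto_natCast_atTop_atTop.eventually_ge_atTop b,
      tendsto_one_div_add_atTop_nhds_zero_nat.eventually_lt_const hε] with n hn hn' u hu
    rw [dist_comm]
    exact (hd n u ((hb hu).trans hn)).trans_lt hn'

/-- Some arc of `φ` inside `[0, β]` is approximately traversed backwards. -/
def Reverses {Y : Type*} [TopologicalSpace Y] (φ : ℝ≥0 → Y) (β : ℝ≥0) : Prop :=
  ∃ u v, u < v ∧ v ≤ β ∧ ∃ s t : ℕ → ℝ≥0, (∀ n, s n < t n) ∧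
    Tendsto (fun n => φ (s n)) atTop (𝓝 (φ v)) ∧ Tendsto (fun n => φ (t n)) atTop (𝓝 (φ u)) ∧
    ∀ W, IsOpen W → φ '' Set.Iic β ⊆ W → ∀ᶠ n in atTop, ∀ x ∈ Set.Icc (s n) (t n), φ x ∈ W

theorem Reverses.comp {Y Y' : Type*} [TopologicalSpace Y] [TopologicalSpace Y'] {φ : ℝ≥0 → Y}
    {β : ℝ≥0} (h : Reverses φ β) {g : Y → Y'} (hg : Continuous g) : Reverses (g ∘ φ) β := by
  obtain ⟨u, v, huv, hv, s, t, hst, hs, ht, hW⟩ := h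
  refine ⟨u, v, huv, hv, s, t, hst, (hg.tendsto _).comp hs, (hg.tendsto _).comp ht,
    fun W hWo hsub => ?_⟩
  refine hW _ (hWo.preimage hg) ?_
  rwa [Set.image_comp, Set.image_subset_iff] at hsub

theorem reverses_of_complex {φ : C(ℝ≥0, ℂ)} (hi : Function.Injective φ) (hrec : ShiftRecurs φ)
    {β : ℝ≥0} (hβ : 0 < β) : Reverses φ β := by
  have hinj : Set.InjOn (fun x : ℝ => φ x.toNNReal) (Set.Ici 0) := fun x hx y hy h => by
    have := congrArg NNReal.toReal (hi h)
    rwa [Real.coe_toNNReal _ hx, Real.coe_toNNReal _ hy] at this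
  have him : (fun x : ℝ => φ x.toNNReal) '' Set.Icc 0 (β : ℝ) = φ '' Set.Iic β := by
    ext z
    constructor
    · rintro ⟨x, hx, rfl⟩
      exact ⟨x.toNNReal, Real.toNNReal_le_iff_le_coe.2 hx.2, rfl⟩
    · rintro ⟨x, hx, rfl⟩
      exact ⟨x, ⟨x.2, hx⟩, by simp⟩
  obtain ⟨u, v, hu, huv, hv, h⟩ := exists_reverse (φ := fun x => φ x.toNNReal) (by fun_prop) hinj
    (fun T ε hε => by
      obtain ⟨t, ht, h⟩ := shiftRecurs_iff.1 hrec T.toNNReal ε hε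
      refine ⟨t, Real.toNNReal_le_iff_le_coe.1 ht, fun x hx => ?_⟩
      have := h x.toNNReal (Real.toNNReal_le_toNNReal hx.2)
      rw [dist_eq_norm, add_comm] at this
      rwa [Real.toNNReal_add t.coe_nonneg hx.1, Real.toNNReal_coe]) le_rfl
    (show (0:ℝ) < β from hβ)
  choose s t hs hst h1 h2 h3 using fun n : ℕ => h (1 / ((n : ℝ) + 1)) (by positivity)
  have hv0 : 0 ≤ v := hu.trans huv.le
  refine ⟨u.toNNReal, v.toNNReal, (Real.toNNReal_lt_toNNReal_iff (hu.trans_lt huv)).2 huv,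
    Real.toNNReal_le_iff_le_coe.2 hv, fun n => (s n).toNNReal, fun n => (t n).toNNReal,
    fun n => (Real.toNNReal_lt_toNNReal_iff ((hs n).trans_lt (hst n))).2 (hst n), ?_, ?_, ?_⟩
  · rw [tendsto_iff_norm_sub_tendsto_zero]
    exact squeeze_zero (fun _ => norm_nonneg _) h1 tendsto_one_div_add_atTop_nhds_zero_nat
  · rw [tendsto_iff_norm_sub_tendsto_zero]
    exact squeeze_zero (fun _ => norm_nonneg _) h2 tendsto_one_div_add_atTop_nhds_zero_nat
  · intro W hW hsub
    rw [him] at h3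
    have hK : IsCompact (φ '' Set.Iic β) := by
      rw [← Set.Icc_bot]
      exact isCompact_Icc.image φ.continuous
    obtain ⟨ε, hε, hth⟩ := hK.exists_thickening_subset_open hW hsub
    filter_upwards [tendsto_one_div_add_atTop_nhds_zero_nat.eventually_lt_const hε] with n hn x hx
    refine hth ((Metric.mem_thickening_iff_infDist_lt ((Set.nonempty_Iic (a := β)).image φ)).2 ?_)
    have := h3 n x ⟨Real.toNNReal_le_iff_le_coe.1 hx.1, ?_⟩
    · rw [Real.toNNReal_coe] at this
      exact this.trans_lt hn
    · exact (NNReal.coe_le_coe.2 hx.2).trans_eq (Real.coe_toNNReal _ ((hs n).trans (hst n).le))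

theorem exists_stereographic_chart (N : Metric.sphere (0 : EuclideanSpace ℝ (Fin 3)) 1) :
    ∃ (c : Metric.sphere (0 : EuclideanSpace ℝ (Fin 3)) 1 → ℂ)
      (d : ℂ → Metric.sphere (0 : EuclideanSpace ℝ (Fin 3)) 1),
      ContinuousOn c {N}ᶜ ∧ Continuous d ∧ (∀ x ≠ N, d (c x) = x) ∧ ∀ z, d z ≠ N ∧ c (d z) = z := by
  have : Fact (Module.finrank ℝ (EuclideanSpace ℝ (Fin 3)) = 2 + 1) := ⟨by simp⟩
  let e := stereographic' 2 N
  let L := Complex.orthonormalBasisOneI.repr.symm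
  have hs : e.source = {N}ᶜ := stereographic'_source N
  have ht : e.target = Set.univ := stereographic'_target N
  refine ⟨fun x => L (e x), fun z => e.symm (L.symm z), ?_, ?_, ?_, ?_⟩
  · exact L.continuous.comp_continuousOn (hs ▸ e.continuousOn)
  · exact (continuousOn_univ.1 (ht ▸ e.symm.continuousOn)).comp L.symm.continuous
  · intro x hx
    simp only [LinearIsometryEquiv.symm_apply_apply]
    exact e.left_inv (by rw [hs]; exact hx)
  · intro z
    have hz : L.symm z ∈ e.target := by simp [ht]
    refine ⟨?_, ?_⟩
    · have := e.map_target hz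
      rwa [hs] at this
    · simp only [e.right_inv hz, LinearIsometryEquiv.apply_symm_apply]

theorem exists_notMem_range {φ : C(ℝ≥0, Metric.sphere (0 : EuclideanSpace ℝ (Fin 3)) 1)}
    (hi : Function.Injective φ) : ∃ N, N ∉ Set.range φ := by
  by_contra hcon
  push Not at hcon
  obtain ⟨c, d, hc, hd, hdc, hcd⟩ := exists_stereographic_chart (φ 0)
  let ψ : ℝ → ℂ := fun t => c (φ t.toNNReal)
  have hne : ∀ t : ℝ, 0 < t → φ t.toNNReal ≠ φ 0 := fun t ht h => by
    exact (Real.toNNReal_pos.2 ht).ne' (hi h)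
  let I : ℕ → Set ℝ := fun n => Set.Icc (1 / ((n : ℝ) + 1)) n
  have hI : ∀ n, ∀ t ∈ I n, 0 < t := fun n t ht =>
    lt_of_lt_of_le (by positivity : (0:ℝ) < 1 / ((n : ℝ) + 1)) ht.1
  have hψ : ∀ n, ContinuousOn ψ (I n) := fun n =>
    hc.comp (by fun_prop) fun t ht => hne t (hI n t ht)
  have hψi : ∀ n, Set.InjOn ψ (I n) := fun n s hs t ht h => by
    have := congrArg d h
    simp only [ψ, hdc _ (hne s (hI n s hs)), hdc _ (hne t (hI n t ht))] at this
    have := congrArg NNReal.toReal (hi this)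
    rwa [Real.coe_toNNReal _ (hI n s hs).le, Real.coe_toNNReal _ (hI n t ht).le] at this
  have hU : ⋃ n, ψ '' I n = Set.univ := by
    refine Set.eq_univ_of_forall fun z => ?_
    obtain ⟨t, ht⟩ := hcon (d z)
    have ht0 : 0 < t := by
      refine pos_iff_ne_zero.2 fun h => (hcd z).1 ?_
      rw [← ht, h]
    obtain ⟨n, hn1, hn2⟩ := ((tendsto_one_div_add_atTop_nhds_zero_nat.eventually_lt_const
      (show (0:ℝ) < t from ht0)).and
      (tendsto_natCast_atTop_atTop.eventually_ge_atTop (t : ℝ))).exists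
    refine Set.mem_iUnion.2 ⟨n, t, ⟨hn1.le, hn2⟩, ?_⟩
    simp only [ψ, Real.toNNReal_coe, ht, (hcd z).2]
  obtain ⟨n, hn⟩ := nonempty_interior_of_iUnion_of_closed
    (fun n => (isCompact_Icc.image_of_continuousOn (hψ n)).isClosed) hU
  rw [interior_arc_eq_empty (hψ n) (hψi n)] at hn
  exact Set.not_nonempty_empty hn

theorem reverses_of_sphere {φ : C(ℝ≥0, Metric.sphere (0 : EuclideanSpace ℝ (Fin 3)) 1)}
    (hi : Function.Injective φ) (hrec : ShiftRecurs φ) {β : ℝ≥0} (hβ : 0 < β) :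
    Reverses φ β := by
  obtain ⟨N, hN⟩ := exists_notMem_range hi
  obtain ⟨c, d, hc, hd, hdc, -⟩ := exists_stereographic_chart N
  have hne : ∀ t, φ t ≠ N := fun t h => hN ⟨t, h⟩
  let φ' : C(ℝ≥0, ({N}ᶜ : Set (Metric.sphere (0 : EuclideanSpace ℝ (Fin 3)) 1))) :=
    ⟨fun t => ⟨φ t, hne t⟩, by fun_prop⟩
  have hrec' : ShiftRecurs φ' := 
    shiftRecurs_iff.2 fun T ε hε => shiftRecurs_iff.1 hrec T ε hε
  let c' : C(({N}ᶜ : Set (Metric.sphere (0 : EuclideanSpace ℝ (Fin 3)) 1)), ℂ) :=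
    ⟨fun x => c x, continuousOn_iff_continuous_domRestrict.1 hc⟩
  have hdφ : d ∘ (c'.comp φ') = φ := funext fun t => hdc _ (hne t)
  have := (reverses_of_complex (φ := c'.comp φ') ?_ (hrec'.comp c') hβ).comp hd
  · rwa [hdφ] at this
  · intro s t h
    exact hi (by rw [← hdφ]; exact congrArg d h)

/-- The projection of the unit sphere onto the projective plane. -/
noncomputable def sphereToProj (x : Metric.sphere (0 : EuclideanSpace ℝ (Fin 3)) 1) :
    Projectivization ℝ (EuclideanSpace ℝ (Fin 3)) :=
  Projectivization.mk ℝ (x : EuclideanSpace ℝ (Fin 3)) (ne_zero_of_mem_unit_sphere x)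

/-- The matrix of the orthogonal projection onto a line. -/
noncomputable def projMatrix (L : Projectivization ℝ (EuclideanSpace ℝ (Fin 3))) :
    Fin 3 × Fin 3 → ℝ :=
  Projectivization.lift (fun (v : {v : EuclideanSpace ℝ (Fin 3) // v ≠ 0}) p =>
    v.1 p.1 * v.1 p.2 / ‖v.1‖ ^ 2) (by
    rintro ⟨a, ha⟩ ⟨b, hb⟩ t rfl
    have ht : t ≠ 0 := fun h => ha (by simp [h])
    have hb' : ‖b‖ ≠ 0 := norm_ne_zero_iff.2 hb
    funext p
    simp only [PiLp.smul_apply, smul_eq_mul, norm_smul, Real.norm_eq_abs, mul_pow, sq_abs]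
    field_simp) L

theorem sphereToProj_surjective : Function.Surjective sphereToProj := by
  intro L
  induction L using Projectivization.ind with
  | h v hv =>
    refine ⟨⟨‖v‖⁻¹ • v, by simp [norm_smul, hv]⟩, ?_⟩
    exact (Projectivization.mk_eq_mk_iff' ℝ _ _ _ _).2 ⟨‖v‖⁻¹, rfl⟩

theorem continuous_sphereToProj : Continuous sphereToProj := by
  have h : Continuous (fun v : {v : EuclideanSpace ℝ (Fin 3) // v ≠ 0} =>
      Projectivization.mk' ℝ v) := continuous_quotient_mk'
  exact h.comp (by fun_prop : Continuous fun x : Metric.sphere (0 : EuclideanSpace ℝ (Fin 3)) 1 =>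
    (⟨x, ne_zero_of_mem_unit_sphere x⟩ : {v : EuclideanSpace ℝ (Fin 3) // v ≠ 0}))

theorem continuous_projMatrix : Continuous projMatrix := by
  refine Continuous.quotient_lift (f := fun v : {v : EuclideanSpace ℝ (Fin 3) // v ≠ 0} =>
    fun p : Fin 3 × Fin 3 => v.1 p.1 * v.1 p.2 / ‖v.1‖ ^ 2) ?_ _
  refine continuous_pi fun p => Continuous.div (by fun_prop) (by fun_prop) fun v => ?_
  exact pow_ne_zero _ (norm_ne_zero_iff.2 v.2)

theorem projMatrix_sphereToProj (x : Metric.sphere (0 : EuclideanSpace ℝ (Fin 3)) 1)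
    (i j : Fin 3) : projMatrix (sphereToProj x) (i, j) = x.1 i * x.1 j := by
  simp [projMatrix, sphereToProj]

theorem projMatrix_injective : Function.Injective projMatrix := by
  intro L M h
  obtain ⟨x, rfl⟩ := sphereToProj_surjective L
  obtain ⟨y, rfl⟩ := sphereToProj_surjective M
  have hxy : ∀ i j, x.1 i * x.1 j = y.1 i * y.1 j := fun i j => by
    rw [← projMatrix_sphereToProj, h, projMatrix_sphereToProj]
  obtain ⟨i, hi⟩ : ∃ i, x.1 i ≠ 0 := by
    by_contra! hc
    exact ne_zero_of_mem_unit_sphere x (PiLp.ext hc)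
  refine (Projectivization.mk_eq_mk_iff' ℝ _ _ _ _).2 ⟨y.1 i / x.1 i, PiLp.ext fun j => ?_⟩
  rw [PiLp.smul_apply, smul_eq_mul, div_mul_eq_mul_div, ← hxy, mul_div_cancel_left₀ _ hi]

instance : T2Space (Projectivization ℝ (EuclideanSpace ℝ (Fin 3))) :=
  T2Space.of_injective_continuous projMatrix_injective continuous_projMatrix

theorem isCoveringMap_sphereToProj : IsCoveringMap sphereToProj := by
  have hG : ∀ g : Metric.sphere (0 : ℝ) 1, g.1 = 1 ∨ g.1 = -1 := fun g =>
    eq_or_eq_neg_of_abs_eq (mem_sphere_zero_iff_norm.1 g.2)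
  have hfin : Finite (Metric.sphere (0 : ℝ) 1) :=
    ((Set.toFinite {1, -1}).subset fun g hg => hG ⟨g, hg⟩).to_subtype
  have hcancel : IsCancelSMul (Metric.sphere (0 : ℝ) 1)
      (Metric.sphere (0 : EuclideanSpace ℝ (Fin 3)) 1) :=
    { left_cancel' := fun g x y h => MulAction.injective g h
      right_cancel' := fun g g' x h => Subtype.ext
        (smul_left_injective ℝ (ne_zero_of_mem_unit_sphere x) (congrArg Subtype.val h)) }
  have hq : IsQuotientMap sphereToProj :=
    continuous_sphereToProj.isClosedMap.isQuotientMap continuous_sphereToProj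
      sphereToProj_surjective
  refine (hq.isQuotientCoveringMap_of_properlyDiscontinuousSMul
    (G := Metric.sphere (0 : ℝ) 1) ?_).isCoveringMap
  intro x y
  rw [sphereToProj, sphereToProj, Projectivization.mk_eq_mk_iff']
  constructor
  · rintro ⟨a, ha⟩
    refine ⟨⟨a, ?_⟩, Subtype.ext ha⟩
    have := congrArg norm ha
    simpa [norm_smul] using this
  · rintro ⟨a, ha⟩
    exact ⟨a, congrArg Subtype.val ha⟩

theorem exists_lift {φ : C(ℝ≥0, Projectivization ℝ (EuclideanSpace ℝ (Fin 3)))} :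
    ∃ Φ : C(ℝ≥0, Metric.sphere (0 : EuclideanSpace ℝ (Fin 3)) 1), sphereToProj ∘ Φ = φ := by
  obtain ⟨x, hx⟩ := sphereToProj_surjective (φ 0)
  obtain ⟨F, ⟨-, hF⟩, -⟩ := isCoveringMap_sphereToProj.existsUnique_continuousMap_lifts
    (φ.comp ⟨Real.toNNReal, continuous_real_toNNReal⟩) 0 x (by simpa using hx)
  refine ⟨F.comp ⟨NNReal.toReal, NNReal.continuous_coe⟩, funext fun t => ?_⟩
  have := congrFun hF t
  simpa using this

theorem two_sub_two_mul_inner_sq_le {x y : Metric.sphere (0 : EuclideanSpace ℝ (Fin 3)) 1} {ε : ℝ}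
    (h : dist (projMatrix (sphereToProj x)) (projMatrix (sphereToProj y)) ≤ ε) :
    2 - 2 * inner ℝ x.1 y.1 ^ 2 ≤ 9 * ε ^ 2 := by
  have hε : 0 ≤ ε := dist_nonneg.trans h
  have hij : ∀ i j, (x.1 i * x.1 j - y.1 i * y.1 j) ^ 2 ≤ ε ^ 2 := fun i j => by
    have := ((dist_le_pi_dist _ _ (i, j)).trans h)
    rw [projMatrix_sphereToProj, projMatrix_sphereToProj, Real.dist_eq] at this
    exact sq_le_sq' (neg_le_of_abs_le this) (le_of_abs_le this)
  have hx : ∑ i, x.1 i ^ 2 = 1 := by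
    rw [← EuclideanSpace.real_norm_sq_eq, norm_eq_of_mem_sphere, one_pow]
  have hy : ∑ i, y.1 i ^ 2 = 1 := by
    rw [← EuclideanSpace.real_norm_sq_eq, norm_eq_of_mem_sphere, one_pow]
  rw [Fin.sum_univ_three] at hx hy
  have hg : inner ℝ x.1 y.1 = x.1 0 * y.1 0 + x.1 1 * y.1 1 + x.1 2 * y.1 2 := by
    simp [PiLp.inner_apply, Fin.sum_univ_three, mul_comm]
  have key : 2 - 2 * inner ℝ x.1 y.1 ^ 2 =
      ∑ i, ∑ j, (x.1 i * x.1 j - y.1 i * y.1 j) ^ 2 := by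
    simp only [hg, Fin.sum_univ_three]
    linear_combination (-(x.1 0 ^ 2 + x.1 1 ^ 2 + x.1 2 ^ 2) - 1) * hx +
      (-(y.1 0 ^ 2 + y.1 1 ^ 2 + y.1 2 ^ 2) - 1) * hy
  rw [key]
  calc ∑ i, ∑ j, (x.1 i * x.1 j - y.1 i * y.1 j) ^ 2 ≤ ∑ _i : Fin 3, ∑ _j : Fin 3, ε ^ 2 :=
        Finset.sum_le_sum fun i _ => Finset.sum_le_sum fun j _ => hij i j
    _ = 9 * ε ^ 2 := by simp; ring

theorem shiftRecurs_lift {Φ : C(ℝ≥0, Metric.sphere (0 : EuclideanSpace ℝ (Fin 3)) 1)}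
    {φ : C(ℝ≥0, Projectivization ℝ (EuclideanSpace ℝ (Fin 3)))} (hΦ : sphereToProj ∘ Φ = φ)
    (hrec : ShiftRecurs φ) : ShiftRecurs Φ := by
  have hM := shiftRecurs_iff.1 (hrec.comp ⟨projMatrix, continuous_projMatrix⟩)
  have hφ : ∀ t, φ t = sphereToProj (Φ t) := fun t => (congrFun hΦ t).symm
  have hunit : ∀ x : Metric.sphere (0 : EuclideanSpace ℝ (Fin 3)) 1, ‖x.1‖ = 1 := by simp
  have hsign : ∀ T : ℝ≥0, ∀ ε > 0, ∃ t ≥ T, (∀ u ≤ T, ‖(Φ (u + t)).1 - (Φ u).1‖ ≤ ε) ∨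
      ∀ u ≤ T, ‖(Φ (u + t)).1 + (Φ u).1‖ ≤ ε := by
    intro T ε hε
    obtain ⟨t, ht, h⟩ := hM T (min (ε / 3) (1 / 9)) (by positivity)
    set η := min (ε / 3) (1 / 9) with hη
    have hη0 : 0 < η := by positivity
    have hη1 : η ≤ ε / 3 := min_le_left _ _
    have hη2 : η ≤ 1 / 9 := min_le_right _ _
    have hin : ∀ u ≤ T, 2 - 2 * inner ℝ (Φ (u + t)).1 (Φ u).1 ^ 2 ≤ 9 * η ^ 2 := fun u hu => by
      refine two_sub_two_mul_inner_sq_le ?_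
      have := h u hu
      simpa [hφ] using this
    have hle : ∀ u : ℝ≥0, |inner ℝ (Φ (u + t)).1 (Φ u).1| ≤ 1 := fun u => by
      have := abs_real_inner_le_norm (Φ (u + t)).1 (Φ u).1
      rwa [hunit, hunit, one_mul] at this
    have hcont : Continuous fun u : ℝ≥0 => (inner ℝ (Φ (u + t)).1 (Φ u).1 : ℝ) := by fun_prop
    have hne : ∀ u ≤ T, (inner ℝ (Φ (u + t)).1 (Φ u).1 : ℝ) ≠ 0 := fun u hu h0 => by
      have := hin u hu
      rw [h0] at this
      nlinarith
    have hsgn : (∀ u ≤ T, 0 ≤ (inner ℝ (Φ (u + t)).1 (Φ u).1 : ℝ)) ∨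
        ∀ u ≤ T, (inner ℝ (Φ (u + t)).1 (Φ u).1 : ℝ) ≤ 0 := by
      by_contra! hc
      obtain ⟨⟨a, ha, ha'⟩, b, hb, hb'⟩ := hc
      obtain ⟨c, hc, hc'⟩ := isPreconnected_Iic.intermediate_value (Set.mem_Iic.2 ha)
        (Set.mem_Iic.2 hb) hcont.continuousOn ⟨ha'.le, hb'.le⟩
      exact hne c hc hc'
    refine ⟨t, ht, hsgn.imp ?_ ?_⟩
    · intro hs u hu
      have h1 := norm_sub_sq_real (Φ (u + t)).1 (Φ u).1
      rw [hunit, hunit] at h1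
      refine le_of_sq_le_sq ?_ hε.le
      nlinarith [hin u hu, hs u hu, (abs_le.1 (hle u)).2]
    · intro hs u hu
      have h1 := norm_add_sq_real (Φ (u + t)).1 (Φ u).1
      rw [hunit, hunit] at h1
      refine le_of_sq_le_sq ?_ hε.le
      nlinarith [hin u hu, hs u hu, (abs_le.1 (hle u)).1]
  rw [shiftRecurs_iff]
  intro T ε hε
  simp only [Subtype.dist_eq, dist_eq_norm]
  obtain ⟨t, ht, h | h⟩ := hsign T (ε / 2) (half_pos hε)
  · exact ⟨t, ht, fun u hu => (h u hu).trans (by linarith)⟩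
  obtain ⟨t', ht', h' | h'⟩ := hsign (T + t) (ε / 2) (half_pos hε)
  · exact ⟨t', le_self_add.trans ht', fun u hu =>
      (h' u (hu.trans le_self_add)).trans (by linarith)⟩
  · refine ⟨t + t', ht.trans le_self_add, fun u hu => ?_⟩
    have h1 := h' (u + t) (by gcongr)
    have h2 := h u hu
    rw [← add_assoc]
    calc ‖(Φ (u + t + t')).1 - (Φ u).1‖
        = ‖((Φ (u + t + t')).1 + (Φ (u + t)).1) - ((Φ (u + t)).1 + (Φ u).1)‖ := by congr 1; abel
      _ ≤ ε / 2 + ε / 2 := (norm_sub_le _ _).trans (add_le_add h1 h2)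
      _ = ε := add_halves ε

/-- Every initial arc of a recurrent injective path in the projective plane contains an arc
which is approximately traversed backwards. -/
theorem reverses_of_projective {φ : C(ℝ≥0, Projectivization ℝ (EuclideanSpace ℝ (Fin 3)))}
    (hi : Function.Injective φ) (hrec : ShiftRecurs φ) {β : ℝ≥0} (hβ : 0 < β) :
    Reverses φ β := by
  obtain ⟨Φ, hΦ⟩ := exists_lift (φ := φ)
  have hi' : Function.Injective Φ := by
    rw [← hΦ] at hi
    exact hi.of_comp
  have := (reverses_of_sphere hi' (shiftRecurs_lift hΦ hrec) hβ).comp continuous_sphereToProj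
  rwa [hΦ] at this

section Dynamics

variable {Y : Type*} [TopologicalSpace Y] {X : Set C(ℝ≥0, Y)}

theorem bebShift_apply (τ : ℝ≥0) (φ : C(ℝ≥0, Y)) (t : ℝ≥0) : bebShift τ φ t = φ (t + τ) := rfl

theorem bebShift_bebShift (τ τ' : ℝ≥0) (φ : C(ℝ≥0, Y)) :
    bebShift τ (bebShift τ' φ) = bebShift (τ + τ') φ := by
  ext t
  simp only [bebShift_apply, add_assoc]

theorem continuous_bebShift (τ : ℝ≥0) : Continuous (bebShift (Z := Y) τ) :=
  ContinuousMap.continuous_precomp _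

/-- The elements of `X` which extend arbitrarily far backwards within `X`. -/
def backwardCore (X : Set C(ℝ≥0, Y)) : Set C(ℝ≥0, Y) :=
  ⋂ m : ℝ≥0, bebShift m '' X

theorem backwardCore_subset : backwardCore X ⊆ X := by
  intro θ hθ
  obtain ⟨ψ, hψ, rfl⟩ := Set.mem_iInter.1 hθ 0
  convert hψ
  ext t
  simp [bebShift_apply]

theorem IsSwitchedBebutovShift.isClosed_backwardCore [T2Space Y] (hX : IsSwitchedBebutovShift X) :
    IsClosed (backwardCore X) :=
  isClosed_iInter fun m => (hX.1.image (continuous_bebShift m)).isClosed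

theorem IsSwitchedBebutovShift.isCompact_backwardCore [T2Space Y]
    (hX : IsSwitchedBebutovShift X) : IsCompact (backwardCore X) :=
  hX.1.of_isClosed_subset hX.isClosed_backwardCore backwardCore_subset

theorem IsSwitchedBebutovShift.bebShift_mem (hX : IsSwitchedBebutovShift X) {θ : C(ℝ≥0, Y)}
    (hθ : θ ∈ backwardCore X) (τ : ℝ≥0) : bebShift τ θ ∈ backwardCore X := by
  refine Set.mem_iInter.2 fun m => ?_
  obtain ⟨ψ, hψ, rfl⟩ := Set.mem_iInter.1 hθ m
  exact ⟨bebShift τ ψ, hX.2.1 ψ hψ τ, by rw [bebShift_bebShift, bebShift_bebShift, add_comm]⟩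

theorem IsSwitchedBebutovShift.mem_backwardCore [T2Space Y] (hX : IsSwitchedBebutovShift X)
    {φ : C(ℝ≥0, Y)} (hφ : φ ∈ X) (hrec : ShiftRecurs φ) : φ ∈ backwardCore X := by
  refine Set.mem_iInter.2 fun m => ?_
  refine (hX.1.image (continuous_bebShift m)).isClosed.mem_of_mapClusterPt hrec ?_
  filter_upwards [eventually_ge_atTop m] with t ht
  exact ⟨bebShift (t - m) φ, hX.2.1 φ hφ _, by rw [bebShift_bebShift, add_tsub_cancel_of_le ht]⟩

theorem IsSwitchedBebutovShift.exists_glue (hX : IsSwitchedBebutovShift X) {f g : C(ℝ≥0, Y)}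
    (hf : f ∈ X) (hg : g ∈ X) {τ : ℝ≥0} (h : f τ = g τ) :
    ∃ ψ ∈ X, (∀ t ≤ τ, ψ t = f t) ∧ ∀ t ≥ τ, ψ t = g t := by
  rcases eq_or_ne τ 0 with rfl | hτ
  · refine ⟨g, hg, fun t ht => ?_, fun _ _ => rfl⟩
    rw [nonpos_iff_eq_zero.1 ht, h]
  let ψ : C(ℝ≥0, Y) := ⟨fun t => if t ≤ τ then f t else g t,
    f.continuous.if_le g.continuous continuous_id continuous_const (by rintro t rfl; exact h)⟩
  have h1 : ∀ t ≤ τ, ψ t = f t := fun t ht => if_pos ht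
  have h2 : ∀ t ≥ τ, ψ t = g t := fun t ht => by
    rcases eq_or_lt_of_le ht with rfl | ht
    · rw [h1 _ le_rfl, h]
    · exact if_neg (not_le.2 ht)
  exact ⟨ψ, hX.2.2 f hf g hg τ (pos_iff_ne_zero.2 hτ) h ψ h1 h2, h1, h2⟩

theorem IsSwitchedBebutovShift.exists_concat (hX : IsSwitchedBebutovShift X) {f g : C(ℝ≥0, Y)}
    (hf : f ∈ backwardCore X) (hg : g ∈ backwardCore X) {τ : ℝ≥0} (h : f τ = g 0) :
    ∃ χ ∈ backwardCore X, (∀ t ≤ τ, χ t = f t) ∧ ∀ t, χ (t + τ) = g t := by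
  choose F hFX hF using fun m => Set.mem_iInter.1 hf m
  choose G hGX hG using fun m => Set.mem_iInter.1 hg m
  have hF' : ∀ m t, F m (t + m) = f t := fun m t => DFunLike.congr_fun (hF m) t
  have hG' : ∀ m t, G m (t + m) = g t := fun m t => DFunLike.congr_fun (hG m) t
  choose ψ hψX hψ1 hψ2 using fun m => hX.exists_glue (hFX m) (hGX (τ + m)) (τ := τ + m) (by
    rw [hF', h, ← hG' (τ + m) 0, zero_add])
  have h1 : ∀ m, ∀ t ≤ τ, ψ m (t + m) = f t := fun m t ht => by
    rw [hψ1 m _ (by gcongr), hF']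
  have h2 : ∀ m t, ψ m (t + τ + m) = g t := fun m t => by
    rw [add_assoc, hψ2 m _ le_add_self, hG']
  refine ⟨ψ 0, Set.mem_iInter.2 fun m => ⟨ψ m, hψX m, ?_⟩, fun t ht => ?_, fun t => ?_⟩
  · ext t
    rw [bebShift_apply]
    rcases le_total t τ with ht | ht
    · rw [h1 m t ht, ← h1 0 t ht, add_zero]
    · obtain ⟨w, rfl⟩ := le_iff_exists_add'.1 ht
      rw [h2 m w, ← h2 0 w, add_zero]
  · rw [← h1 0 t ht, add_zero]
  · rw [← h2 0 t, add_zero]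

theorem IsSwitchedBebutovShift.exists_periodic [T2Space Y] (hX : IsSwitchedBebutovShift X)
    {g : C(ℝ≥0, Y)} (hg : g ∈ backwardCore X) {p : ℝ≥0} (h : g p = g 0) :
    ∃ χ ∈ backwardCore X, (∀ t ≤ p, χ t = g t) ∧ ∀ t, χ (t + p) = χ t := by
  have key : ∀ k : ℕ, ∃ χ ∈ backwardCore X, (∀ t ≤ p, χ t = g t) ∧
      ∀ t, t + p ≤ k * p → χ (t + p) = χ t := by
    intro k
    induction k with
    | zero =>
      refine ⟨g, hg, fun _ _ => rfl, fun t ht => ?_⟩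
      rw [Nat.cast_zero, zero_mul, nonpos_iff_eq_zero, add_eq_zero] at ht
      rw [ht.1, ht.2, add_zero]
    | succ k ih =>
      obtain ⟨χ, hχ, hχg, hχp⟩ := ih
      obtain ⟨χ', hχ', h1, h2⟩ := hX.exists_concat hg hχ (τ := p) (by rw [h, hχg 0 zero_le])
      refine ⟨χ', hχ', h1, fun t ht => ?_⟩
      rw [h2]
      rcases le_total t p with htp | htp
      · rw [hχg t htp, h1 t htp]
      · obtain ⟨w, rfl⟩ := le_iff_exists_add'.1 htp
        rw [h2]
        refine hχp w (le_of_add_le_add_right (a := p) ?_)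
        rwa [Nat.cast_add, Nat.cast_one, add_mul, one_mul] at ht
  choose χ hχ hχg hχp using key
  obtain ⟨θ, hθ, hcl⟩ := hX.isCompact_backwardCore.exists_mapClusterPt
    (f := atTop) (u := χ) (tendsto_principal.2 (Eventually.of_forall hχ))
  refine ⟨θ, hθ, fun t ht => ?_, fun t => ?_⟩
  · exact (isClosed_eq (continuous_eval_const t) continuous_const).mem_of_mapClusterPt
      (s := {χ : C(ℝ≥0, Y) | χ t = g t}) hcl (Eventually.of_forall fun k => hχg k t ht)
  · refine (isClosed_eq (continuous_eval_const (t + p))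
      (continuous_eval_const t)).mem_of_mapClusterPt
      (s := {χ : C(ℝ≥0, Y) | χ (t + p) = χ t}) hcl ?_
    rcases eq_or_ne p 0 with rfl | hp
    · exact Eventually.of_forall fun k => by simp
    obtain ⟨N, hN⟩ := exists_nat_ge ((t + p) / p)
    filter_upwards [eventually_ge_atTop N] with k hk
    refine hχp k t ?_
    rw [← div_le_iff₀ (pos_iff_ne_zero.2 hp)]
    exact hN.trans (by exact_mod_cast hk)

theorem mem_of_periodic {χ : C(ℝ≥0, Y)} {p : ℝ≥0} (hp : 0 < p) (hχ : ∀ t, χ (t + p) = χ t)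
    {K : Set Y} (hK : ∀ t ≤ p, χ t ∈ K) (t : ℝ≥0) : χ t ∈ K := by
  have key : ∀ n : ℕ, ∀ t ≤ n * p, χ t ∈ K := by
    intro n
    induction n with
    | zero => exact fun t ht => hK t (by simp_all)
    | succ n ih =>
      intro t ht
      rcases le_total t p with h | h
      · exact hK t h
      · obtain ⟨w, rfl⟩ := le_iff_exists_add'.1 h
        rw [hχ]
        refine ih w (le_of_add_le_add_right (a := p) ?_)
        rwa [Nat.cast_add, Nat.cast_one, add_mul, one_mul] at ht
  obtain ⟨N, hN⟩ := exists_nat_ge (t / p)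
  exact key N t ((div_le_iff₀ hp).1 hN)

theorem IsSwitchedBebutovShift.exists_preperiodic [T2Space Y] (hX : IsSwitchedBebutovShift X)
    {φ : C(ℝ≥0, Y)} (hφ : φ ∈ backwardCore X) (hi : ¬Function.Injective φ) :
    ∃ χ ∈ X, (∃ T p : ℝ≥0, 0 < p ∧ ∀ t : ℝ≥0, T ≤ t → χ (t + p) = χ t) ∧ χ 0 = φ 0 := by
  obtain ⟨s, t, he, hst⟩ : ∃ s t, φ s = φ t ∧ s < t := by
    simp only [Function.Injective, not_forall] at hi
    obtain ⟨s, t, he, hne⟩ := hi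
    rcases lt_or_gt_of_ne hne with h | h
    · exact ⟨s, t, he, h⟩
    · exact ⟨t, s, he.symm, h⟩
  obtain ⟨χ, hχ, h1, h2⟩ := hX.exists_periodic (hX.bebShift_mem hφ s) (p := t - s) (by
    rw [bebShift_apply, bebShift_apply, tsub_add_cancel_of_le hst.le, zero_add, he])
  obtain ⟨ψ, hψ, h3, h4⟩ := hX.exists_concat hφ hχ (τ := s) (by
    rw [h1 0 zero_le, bebShift_apply, zero_add])
  refine ⟨ψ, backwardCore_subset hψ, ⟨s, t - s, tsub_pos_of_lt hst, fun x hx => ?_⟩, h3 0 zero_le⟩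
  obtain ⟨w, rfl⟩ := le_iff_exists_add'.1 hx
  rw [add_right_comm, h4, h4, h2]

theorem IsSwitchedBebutovShift.exists_mem_arc [T2Space Y] (hX : IsSwitchedBebutovShift X)
    {φ : C(ℝ≥0, Y)} (hφ : φ ∈ backwardCore X) {β : ℝ≥0} (hrev : Reverses φ β) :
    ∃ χ ∈ X, ∀ t, χ t ∈ φ '' Set.Iic β := by
  obtain ⟨u, v, huv, hvβ, s, t, hst, hs, ht, hW⟩ := hrev
  let 𝒰 : Ultrafilter ℕ := Filter.hyperfilter ℕ
  have hle : (𝒰 : Filter ℕ) ≤ atTop := Nat.hyperfilter_le_atTop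
  have hK : IsCompact (φ '' Set.Iic β) := by
    rw [← Set.Icc_bot]
    exact isCompact_Icc.image φ.continuous
  obtain ⟨θ, hθ, hlim⟩ := hX.isCompact_backwardCore.ultrafilter_le_nhds'
    (𝒰.map fun n => bebShift (s n) φ)
    (Eventually.of_forall (f := (𝒰 : Filter ℕ)) fun n => hX.bebShift_mem hφ (s n))
  replace hlim : Tendsto (fun n => bebShift (s n) φ) 𝒰 (𝓝 θ) := hlim
  have hin : ∀ x, (∀ᶠ n in (𝒰 : Filter ℕ), x ≤ t n - s n) → θ x ∈ φ '' Set.Iic β := by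
    intro x hx
    by_contra hcon
    obtain ⟨W, V, hWo, hVo, hKW, hV, hd⟩ := SeparatedNhds.of_isCompact_isCompact hK
      isCompact_singleton (Set.disjoint_singleton_right.2 hcon)
    have h1 : ∀ᶠ n in (𝒰 : Filter ℕ), φ (x + s n) ∈ V :=
      ((continuous_eval_const x).tendsto θ |>.comp hlim).eventually (hVo.mem_nhds (hV rfl))
    obtain ⟨n, hn1, hn2, hn3⟩ := (h1.and (hx.and (hle (hW W hWo hKW)))).exists
    refine Set.disjoint_left.1 hd (hn3 (x + s n) ⟨le_add_self, ?_⟩) hn1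
    exact (add_le_add_left hn2 _).trans_eq (tsub_add_cancel_of_le (hst n).le)
  have h0 : θ 0 = φ v := by
    refine tendsto_nhds_unique ((continuous_eval_const (0 : ℝ≥0)).tendsto θ |>.comp hlim) ?_
    simpa [Function.comp_def, bebShift_apply] using hs.mono_left hle
  by_cases hb : ∃ L, ∀ᶠ n in (𝒰 : Filter ℕ), t n - s n ≤ L
  · obtain ⟨L, hL⟩ := hb
    obtain ⟨l, -, hl⟩ := (isCompact_Icc (a := 0) (b := L)).ultrafilter_le_nhds'
      (𝒰.map fun n => t n - s n) (hL.mono fun n hn => ⟨zero_le, hn⟩)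
    replace hl : Tendsto (fun n => t n - s n) 𝒰 (𝓝 l) := hl
    have hθl : θ l = φ u := by
      refine tendsto_nhds_unique (hlim.eval hl) ?_
      simpa [bebShift_apply, tsub_add_cancel_of_le (hst _).le] using ht.mono_left hle
    have hθK : ∀ x ≤ l, θ x ∈ φ '' Set.Iic β := by
      intro x hx
      rcases eq_or_lt_of_le hx with rfl | hx
      · exact ⟨u, huv.le.trans hvβ, hθl.symm⟩
      · exact hin x ((hl.eventually_const_lt hx).mono fun n hn => hn.le)
    obtain ⟨g, hg, h1, h2⟩ := hX.exists_concat (hX.bebShift_mem hφ u) hθ (τ := v - u) (by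
      rw [bebShift_apply, tsub_add_cancel_of_le huv.le, h0])
    obtain ⟨χ, hχ, h3, h4⟩ := hX.exists_periodic hg (p := l + (v - u)) (by
      rw [h2, hθl, h1 0 zero_le, bebShift_apply, zero_add])
    refine ⟨χ, backwardCore_subset hχ,
      mem_of_periodic (add_pos_of_nonneg_of_pos zero_le (tsub_pos_of_lt huv)) h4 fun x hx => ?_⟩
    rw [h3 x hx]
    rcases le_total x (v - u) with hxv | hxv
    · rw [h1 x hxv]
      refine ⟨x + u, ?_, rfl⟩
      exact ((add_le_add_left hxv u).trans_eq (tsub_add_cancel_of_le huv.le)).trans hvβ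
    · obtain ⟨w, rfl⟩ := le_iff_exists_add'.1 hxv
      rw [h2]
      exact hθK w (le_of_add_le_add_right hx)
  · refine ⟨θ, backwardCore_subset hθ, fun x => hin x ?_⟩
    have : ¬∀ᶠ n in (𝒰 : Filter ℕ), t n - s n ≤ x := fun h => hb ⟨x, h⟩
    rw [← Ultrafilter.eventually_not] at this
    exact this.mono fun n hn => (not_le.1 hn).le

theorem IsSwitchedBebutovShift.exists_const [T2Space Y] (hX : IsSwitchedBebutovShift X)
    {φ : C(ℝ≥0, Y)} (hi : Function.Injective φ)
    (h : ∀ β > 0, ∃ χ ∈ X, ∀ t, χ t ∈ φ '' Set.Iic β) : ∃ χ ∈ X, ∀ t, χ t = φ 0 := by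
  choose χ hχX hχ using fun n : ℕ => h (1 / ((n : ℝ≥0) + 1)) (by positivity)
  obtain ⟨θ, hθ, hcl⟩ := hX.1.exists_mapClusterPt
    (f := atTop) (u := χ) (tendsto_principal.2 (Eventually.of_forall hχX))
  refine ⟨θ, hθ, fun t => ?_⟩
  have hmem : ∀ β > 0, θ t ∈ φ '' Set.Iic β := by
    intro β hβ
    have hK : IsClosed (φ '' Set.Iic β) := by
      rw [← Set.Icc_bot]
      exact (isCompact_Icc.image φ.continuous).isClosed
    refine (hK.preimage (continuous_eval_const t)).mem_of_mapClusterPt hcl ?_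
    filter_upwards [tendsto_one_div_add_atTop_nhds_zero_nat.eventually_lt_const
      (NNReal.coe_pos.2 hβ)] with n hn
    refine Set.image_mono (Set.Iic_subset_Iic.2 ?_) (hχ n t)
    exact NNReal.coe_le_coe.1 (by push_cast; exact hn.le)
  obtain ⟨x, -, hx⟩ := hmem 1 one_pos
  rcases eq_or_ne x 0 with rfl | hx0
  · exact hx.symm
  obtain ⟨y, hy, hy'⟩ := hmem (x / 2) (half_pos (pos_iff_ne_zero.2 hx0))
  rw [← hx] at hy'
  rw [hi hy'] at hy
  exact absurd hy (not_le.2 (NNReal.half_lt_self hx0))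

end Dynamics

theorem Topology.IsInducing.reverses {Y Y' : Type*} [TopologicalSpace Y] [TopologicalSpace Y']
    {g : Y → Y'} (hg : IsInducing g) {φ : ℝ≥0 → Y} {β : ℝ≥0} (h : Reverses (g ∘ φ) β) :
    Reverses φ β := by
  obtain ⟨u, v, huv, hv, s, t, hst, hs, ht, hW⟩ := h
  refine ⟨u, v, huv, hv, s, t, hst, hg.tendsto_nhds_iff.2 hs, hg.tendsto_nhds_iff.2 ht,
    fun W hWo hsub => ?_⟩
  obtain ⟨W', hW', rfl⟩ := hg.isOpen_iff.1 hWo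
  exact hW W' hW' (by rwa [Set.image_comp, Set.image_subset_iff])

/-- Poincaré–Bendixson theorem for switched Bebutov shifts with values in a compact subset
of the real projective plane `ℝP²`. -/
theorem switched_bebutov_projective_preperiodic
    (Z : Set (Projectivization ℝ (EuclideanSpace ℝ (Fin 3)))) (hZc : IsCompact Z)
    (X : Set C(ℝ≥0, Z)) (hX : IsSwitchedBebutovShift X)
    (φ : C(ℝ≥0, Z)) (hφ : φ ∈ X) (hrec : IsShiftRecurrent φ) :
    (∃ χ ∈ X, (∃ T p : ℝ≥0, 0 < p ∧ ∀ t : ℝ≥0, T ≤ t → χ (t + p) = χ t) ∧ χ 0 = φ 0) ∧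
    (Function.Injective φ → ∃ χ ∈ X, (∀ t : ℝ≥0, χ t = φ 0)) := by
  have hr := hrec.shiftRecurs
  have hcore := hX.mem_backwardCore hφ hr
  have hconst : Function.Injective φ → ∃ χ ∈ X, (∀ t : ℝ≥0, χ t = φ 0) := fun hi =>
    hX.exists_const hi fun β hβ => hX.exists_mem_arc hcore <| IsInducing.subtypeVal.reverses
      (reverses_of_projective (φ := ContinuousMap.comp ⟨Subtype.val, continuous_subtype_val⟩ φ)
        (Subtype.val_injective.comp hi) (hr.comp _) hβ)
  refine ⟨?_, hconst⟩
  by_cases hi : Function.Injective φ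
  · obtain ⟨χ, hχ, hc⟩ := hconst hi
    exact ⟨χ, hχ, ⟨0, 1, one_pos, fun t _ => by rw [hc, hc]⟩, hc 0⟩
  · exact hX.exists_preperiodic hcore hi
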